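/- The standard monomials in {p(A,B) : (A,B) ∈ H_p} ∪ {u(I) : I ∈ H_u} ∪ {ξ(J) : J ∈ H_ξ} (including the empty monomial 1) form a basis of the ring of invariants K[X]^{SL_n(K)} as a K-vector space. -/

import Mathlib

namespace SMB

/-- `geTup f g` : the strictly increasing tuple `f` is `≥` the strictly increasing tuple `g`
in the order on increasing tuples: the length of `f` is at most that of `g`, and `f` is
entrywise `≥` `g` (on the common range of indices). -/
def geTup {N s s' : ℕ} (f : Fin s → Fin N) (g : Fin s' → Fin N) : Prop :=
  ∃ h : s ≤ s', ∀ j : Fin s, g (Fin.castLE h j) ≤ f j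

/-- A strictly increasing `s`-tuple with values in `{1,…,N}` (encoded as `Fin N`). -/
structure IncTup (s N : ℕ) where
  f : Fin s → Fin N
  mono : StrictMono f

/-- A pair of strictly increasing tuples of a common length `s`: row indices in `{1,…,m}`
and column indices in `{1,…,q}`, indexing an `s × s` minor. -/
structure PairIx (m q : ℕ) where
  s : ℕ
  rows : Fin s → Fin m
  cols : Fin s → Fin q
  rmono : StrictMono rows
  cmono : StrictMono cols

/-- The partial order `(A,B) ⪰ (A',B')` on pairs of increasing tuples: `A ≥ A'` and `B ≥ B'`. -/
def PairIx.ge {m q : ℕ} (x y : PairIx m q) : Prop :=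
  geTup x.rows y.rows ∧ geTup x.cols y.cols

end SMB
namespace SMB

variable (K : Type) [Field K] (n m q : ℕ)

/-- The coordinate ring `K[X]` of `X = M_{m,n}(K) × M_{n,q}(K)`: the polynomial ring over `K`
in the entries of a generic `m×n` matrix `U` and a generic `n×q` matrix `W`. -/
abbrev KX := MvPolynomial ((Fin m × Fin n) ⊕ (Fin n × Fin q)) K

/-- The generic `m×n` matrix `U = (u_{ij})`. -/
noncomputable def Ugen : Matrix (Fin m) (Fin n) (KX K n m q) :=
  Matrix.of fun i j => MvPolynomial.X (Sum.inl (i, j))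

/-- The generic `n×q` matrix `W = (ξ_{kl})`. -/
noncomputable def Wgen : Matrix (Fin n) (Fin q) (KX K n m q) :=
  Matrix.of fun k l => MvPolynomial.X (Sum.inr (k, l))

/-- `φ_{ij}`, the `(i,j)` entry of the product matrix `UW`. -/
noncomputable def phi (i : Fin m) (j : Fin q) : KX K n m q :=
  (Ugen K n m q * Wgen K n m q) i j

/-- Evaluation of a polynomial in `K[X]` at a point `(U, W) ∈ X`. -/
noncomputable def evalX (U : Matrix (Fin m) (Fin n) K) (W : Matrix (Fin n) (Fin q) K) :
    KX K n m q →+* K :=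
  MvPolynomial.eval (Sum.elim (fun p => U p.1 p.2) (fun p => W p.1 p.2))

variable {K n m q}

/-- `f ∈ K[X]` is invariant under the diagonal action of `GL_n(K)`:
`f(UA, A⁻¹W) = f(U, W)` for all `A ∈ GL_n(K)` and all `(U,W) ∈ X`. -/
def IsGLInvariant (f : KX K n m q) : Prop :=
  ∀ (A : GL (Fin n) K) (U : Matrix (Fin m) (Fin n) K) (W : Matrix (Fin n) (Fin q) K),
    evalX K n m q (U * (A : Matrix (Fin n) (Fin n) K))
      (((A⁻¹ : GL (Fin n) K) : Matrix (Fin n) (Fin n) K) * W) f = evalX K n m q U W f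

/-- `f ∈ K[X]` is invariant under the diagonal action of `SL_n(K)`:
`f(UA, A⁻¹W) = f(U, W)` for all `A ∈ SL_n(K)` and all `(U,W) ∈ X`. -/
def IsSLInvariant (f : KX K n m q) : Prop :=
  ∀ (A : Matrix.SpecialLinearGroup (Fin n) K)
    (U : Matrix (Fin m) (Fin n) K) (W : Matrix (Fin n) (Fin q) K),
    evalX K n m q (U * (A : Matrix (Fin n) (Fin n) K))
      (((A⁻¹ : Matrix.SpecialLinearGroup (Fin n) K) : Matrix (Fin n) (Fin n) K) * W) f
      = evalX K n m q U W f

variable (K n m q)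

end SMB
namespace SMB

variable (K : Type) [Field K] (n m q : ℕ)

/-- The ring of invariants `K[X]^{SL_n(K)}`, as a subalgebra of `K[X]`. -/
noncomputable def slInvariants : Subalgebra K (KX K n m q) where
  carrier := {f | IsSLInvariant f}
  mul_mem' := by
    intro a b ha hb A U W
    rw [map_mul, map_mul, ha A U W, hb A U W]
  one_mem' := by intro A U W; rw [map_one, map_one]
  add_mem' := by
    intro a b ha hb A U W
    rw [map_add, map_add, ha A U W, hb A U W]
  zero_mem' := by intro A U W; rw [map_zero, map_zero]
  algebraMap_mem' := by
    intro c A U W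
    simp only [MvPolynomial.algebraMap_eq, evalX, MvPolynomial.eval_C]

end SMB
namespace SMB

variable (K : Type) [Field K] (n m q : ℕ)

/-- `p(A,B)`: the minor of the product matrix `UW` with row indices `A` and column indices `B`. -/
noncomputable def pPoly (x : PairIx m q) : KX K n m q :=
  Matrix.det (Matrix.of fun i j : Fin x.s =>
    (Ugen K n m q * Wgen K n m q) (x.rows i) (x.cols j))

/-- `u(I)`: the maximal (`n×n`) minor of `U` with row indices `I`. -/
noncomputable def uPoly (I : Fin n → Fin m) : KX K n m q :=
  Matrix.det (Matrix.of fun i j : Fin n => MvPolynomial.X (Sum.inl (I i, j)))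

/-- `ξ(J)`: the maximal (`n×n`) minor of `W` with column indices `J`. -/
noncomputable def xiPoly (J : Fin n → Fin q) : KX K n m q :=
  Matrix.det (Matrix.of fun i j : Fin n => MvPolynomial.X (Sum.inr (i, J j)))

end SMB
namespace SMB

variable (n m q : ℕ)

/-- The index set `H = H_u ⊔ H_ξ ⊔ H_p`, where `H_u = I(n,m)`, `H_ξ = I(n,q)` and
`H_p = ⋃_{1 ≤ r ≤ n} I(r,m) × I(r,q)`. -/
abbrev HElt := IncTup n m ⊕ (IncTup n q ⊕ {x : PairIx m q // 0 < x.s ∧ x.s ≤ n})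

variable {n m q}

/-- The partial order on `H`: componentwise order on `H_u` and on `H_ξ`; the order `⪰` on
`H_p`; elements of `H_u` and `H_ξ` mutually incomparable; no element of `H_u ∪ H_ξ` above
any element of `H_p`; `I ≤ (A,B)` iff `I ≤ A`, and `J ≤ (A,B)` iff `J ≤ B`. -/
def hle : HElt n m q → HElt n m q → Prop
  | Sum.inl I, Sum.inl I' => ∀ j, I.f j ≤ I'.f j
  | Sum.inl I, Sum.inr (Sum.inr P) => geTup P.val.rows I.f
  | Sum.inr (Sum.inl J), Sum.inr (Sum.inl J') => ∀ j, J.f j ≤ J'.f j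
  | Sum.inr (Sum.inl J), Sum.inr (Sum.inr P) => geTup P.val.cols J.f
  | Sum.inr (Sum.inr P), Sum.inr (Sum.inr P') => PairIx.ge P'.val P.val
  | _, _ => False

end SMB
namespace SMB

variable (K : Type) [Field K] (n m q : ℕ)

/-- The regular function on `X` attached to an element of `H`:
`u(I)` for `I ∈ H_u`, `ξ(J)` for `J ∈ H_ξ`, and `p(A,B)` for `(A,B) ∈ H_p`. -/
noncomputable def polyOf : HElt n m q → KX K n m q
  | Sum.inl I => uPoly K n m q I.f
  | Sum.inr (Sum.inl J) => xiPoly K n m q J.f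
  | Sum.inr (Sum.inr P) => pPoly K n m q P.val

variable {n m q}

/-- A list of elements of `H` indexes a standard monomial iff it does not involve both some
`u(I)` and some `ξ(J)`, and it is weakly decreasing for the partial order on `H`. -/
def IsStandardList (L : List (HElt n m q)) : Prop :=
  (¬ ((∃ I : IncTup n m, Sum.inl I ∈ L) ∧
      (∃ J : IncTup n q, Sum.inr (Sum.inl J) ∈ L))) ∧
  L.Chain' fun a b => hle b a

end SMB


namespace SMB

section HasLead

open MvPolynomial

variable {σ τ R Γ : Type*} [CommRing R]

/-- `HasLead wt g d`: the monomial `d` has coefficient `1` in `g`, and every other monomial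
of `g` has strictly smaller weight than `d`. -/
def HasLead [AddCommMonoid Γ] [LT Γ] (wt : (σ →₀ ℕ) →+ Γ) (g : MvPolynomial σ R)
    (d : σ →₀ ℕ) : Prop :=
  coeff d g = 1 ∧ ∀ e, coeff e g ≠ 0 → e ≠ d → wt e < wt d

variable [AddCommMonoid Γ] [LinearOrder Γ] {wt : (σ →₀ ℕ) →+ Γ}

theorem HasLead.le {g : MvPolynomial σ R} {d e : σ →₀ ℕ} (h : HasLead wt g d)
    (he : coeff e g ≠ 0) : wt e ≤ wt d := by
  by_cases hed : e = d
  · rw [hed]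
  · exact (h.2 e he hed).le

theorem hasLead_monomial (d : σ →₀ ℕ) : HasLead wt (monomial d (1 : R)) d := by
  classical
  refine ⟨by simp, fun e he hne => ?_⟩
  rw [coeff_monomial, if_neg (Ne.symm hne)] at he
  exact absurd rfl he

/-- A sum of scalar multiples of monomials, one of which has coefficient `1` and strictly
dominates the weights of all the others. -/
theorem hasLead_sum {ι : Type*} (s : Finset ι) (c : ι → R) (d : ι → σ →₀ ℕ) {i₀ : ι}
    (hi₀ : i₀ ∈ s) (hc : c i₀ = 1) (h : ∀ i ∈ s, i ≠ i₀ → wt (d i) < wt (d i₀)) :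
    HasLead wt (∑ i ∈ s, monomial (d i) (c i)) (d i₀) := by
  classical
  constructor
  · rw [coeff_sum, Finset.sum_eq_single i₀]
    · simp [hc]
    · intro i hi hne
      rw [coeff_monomial, if_neg]
      intro heq
      exact (h i hi hne).ne (by rw [heq])
    · exact fun hn => absurd hi₀ hn
  · intro e he hne
    rw [coeff_sum] at he
    obtain ⟨i, hi, hcon⟩ := Finset.exists_ne_zero_of_sum_ne_zero he
    rw [coeff_monomial] at hcon
    have hie : d i = e := by
      by_contra hn
      exact hcon (if_neg hn)
    rw [← hie]
    exact h i hi fun hii => hne (by rw [← hie, hii])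

theorem hasLead_one : HasLead wt (1 : MvPolynomial σ R) 0 :=
  hasLead_monomial 0

variable [IsOrderedCancelAddMonoid Γ]

theorem HasLead.mul {g h : MvPolynomial σ R} {d e : σ →₀ ℕ} (hg : HasLead wt g d)
    (hh : HasLead wt h e) : HasLead wt (g * h) (d + e) := by
  classical
  constructor
  · rw [coeff_mul, Finset.sum_eq_single (d, e)]
    · simp [hg.1, hh.1]
    · rintro ⟨a, b⟩ hab hne
      by_contra hcon
      have ha : coeff a g ≠ 0 := left_ne_zero_of_mul hcon
      have hb : coeff b h ≠ 0 := right_ne_zero_of_mul hcon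
      have hsum : wt a + wt b = wt d + wt e := by
        rw [← map_add, ← map_add, Finset.HasAntidiagonal.mem_antidiagonal.1 hab]
      by_cases had : a = d
      · have hbe : b ≠ e := fun hbe => hne (by rw [had, hbe])
        exact (add_lt_add_of_le_of_lt (hg.le ha) (hh.2 b hb hbe)).ne hsum
      · exact (add_lt_add_of_lt_of_le (hg.2 a ha had) (hh.le hb)).ne hsum
    · intro hmem
      simp at hmem
  · intro c hc hne
    rw [coeff_mul] at hc
    obtain ⟨⟨a, b⟩, hab, hcon⟩ := Finset.exists_ne_zero_of_sum_ne_zero hc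
    have ha : coeff a g ≠ 0 := left_ne_zero_of_mul hcon
    have hb : coeff b h ≠ 0 := right_ne_zero_of_mul hcon
    have hab' : a + b = c := Finset.HasAntidiagonal.mem_antidiagonal.1 hab
    rw [← hab', map_add, map_add]
    by_cases had : a = d
    · have hbe : b ≠ e := fun hbe => hne (by rw [← hab', had, hbe])
      exact add_lt_add_of_le_of_lt (hg.le ha) (hh.2 b hb hbe)
    · exact add_lt_add_of_lt_of_le (hg.2 a ha had) (hh.le hb)

theorem HasLead.pow {g : MvPolynomial σ R} {d : σ →₀ ℕ} (hg : HasLead wt g d) (k : ℕ) :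
    HasLead wt (g ^ k) (k • d) := by
  induction k with
  | zero => simpa using hasLead_one
  | succ k ih => rw [pow_succ, succ_nsmul]; exact ih.mul hg

theorem hasLead_prod {ι : Type*} (s : Finset ι) {g : ι → MvPolynomial σ R}
    {d : ι → σ →₀ ℕ} (h : ∀ i ∈ s, HasLead wt (g i) (d i)) :
    HasLead wt (∏ i ∈ s, g i) (∑ i ∈ s, d i) := by
  classical
  induction s using Finset.induction_on with
  | empty => simpa using hasLead_one
  | insert a s ha ih =>
    rw [Finset.prod_insert ha, Finset.sum_insert ha]
    exact (h a (Finset.mem_insert_self a s)).mul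
      (ih fun i hi => h i (Finset.mem_insert_of_mem hi))

theorem hasLead_list_prod {ι : Type*} {g : ι → MvPolynomial σ R} {d : ι → σ →₀ ℕ}
    (h : ∀ i, HasLead wt (g i) (d i)) (l : List ι) :
    HasLead wt (l.map g).prod (l.map d).sum := by
  induction l with
  | nil => simpa using hasLead_one
  | cons a l ih => simpa using (h a).mul ih

/-- If each generator is sent to a polynomial led by the variable `μ i`, then a monomial `d` is
sent to a polynomial led by `d.mapDomain μ`. -/
theorem hasLead_aeval_monomial {g : τ → MvPolynomial σ R} {μ : τ → σ}
    (h : ∀ i, HasLead wt (g i) (Finsupp.single (μ i) 1)) (d : τ →₀ ℕ) :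
    HasLead wt (aeval g (monomial d (1 : R))) (d.mapDomain μ) := by
  rw [aeval_monomial, map_one, one_mul, Finsupp.mapDomain, Finsupp.prod, Finsupp.sum]
  refine hasLead_prod _ fun i _ => ?_
  simpa using (h i).pow (d i)

theorem isWeightedHomogeneous_aeval_monomial {M : Type*} [AddCommMonoid M]
    {g : τ → MvPolynomial σ R} {v : τ → M} {w : σ → M}
    (h : ∀ i, IsWeightedHomogeneous w (g i) (v i)) (d : τ →₀ ℕ) :
    IsWeightedHomogeneous w (aeval g (monomial d (1 : R))) (Finsupp.weight v d) := by
  rw [aeval_monomial, map_one, one_mul, Finsupp.prod, Finsupp.weight_apply, Finsupp.sum]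
  exact IsWeightedHomogeneous.prod _ _ _ fun i _ => (h i).pow (d i)

/-- If all monomials of each `g i` have weight at least `v i`, then all monomials of the image
of `d` have weight at least `weight v d`. -/
theorem weight_le_of_coeff_aeval_monomial_ne_zero {g : τ → MvPolynomial σ R} {v : τ → ℕ}
    {w : σ → ℕ} (h : ∀ i e, coeff e (g i) ≠ 0 → v i ≤ Finsupp.weight w e) (d : τ →₀ ℕ)
    {e : σ →₀ ℕ} (he : coeff e (aeval g (monomial d (1 : R))) ≠ 0) :
    Finsupp.weight v d ≤ Finsupp.weight w e := by
  classical
  have mul : ∀ {a b : MvPolynomial σ R} {k l : ℕ},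
      (∀ e, coeff e a ≠ 0 → k ≤ Finsupp.weight w e) →
      (∀ e, coeff e b ≠ 0 → l ≤ Finsupp.weight w e) →
      ∀ e, coeff e (a * b) ≠ 0 → k + l ≤ Finsupp.weight w e := by
    intro a b k l ha hb e he
    rw [coeff_mul] at he
    obtain ⟨⟨x, y⟩, hxy, hcon⟩ := Finset.exists_ne_zero_of_sum_ne_zero he
    rw [← Finset.HasAntidiagonal.mem_antidiagonal.1 hxy, map_add]
    exact add_le_add (ha x (left_ne_zero_of_mul hcon)) (hb y (right_ne_zero_of_mul hcon))
  have pow : ∀ i k e, coeff e (g i ^ k) ≠ 0 → k * v i ≤ Finsupp.weight w e := by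
    intro i k
    induction k with
    | zero => intro e _; simp
    | succ k ih =>
      intro e he
      rw [pow_succ] at he
      rw [add_mul, one_mul]
      exact mul ih (h i) e he
  have prod : ∀ s : Finset τ, ∀ e, coeff e (∏ i ∈ s, g i ^ d i) ≠ 0 →
      ∑ i ∈ s, d i * v i ≤ Finsupp.weight w e := by
    intro s
    induction s using Finset.induction_on with
    | empty => intro e _; simp
    | insert a s ha ih =>
      intro e he
      rw [Finset.prod_insert ha] at he
      rw [Finset.sum_insert ha]
      exact mul (pow a (d a)) ih e he
  rw [aeval_monomial, map_one, one_mul, Finsupp.prod] at he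
  simpa [Finsupp.weight_apply, Finsupp.sum] using prod _ e he

theorem coeff_aeval_eq_sum (g : τ → MvPolynomial σ R) (f : MvPolynomial τ R) (e : σ →₀ ℕ) :
    coeff e (aeval g f) =
      ∑ d ∈ f.support, coeff d f * coeff e (aeval g (monomial d (1 : R))) := by
  conv_lhs => rw [f.as_sum]
  rw [map_sum, coeff_sum]
  refine Finset.sum_congr rfl fun d _ => ?_
  rw [← coeff_C_mul, ← mul_one (coeff d f), ← C_mul_monomial, map_mul, mul_one]
  congr 1
  simp

end HasLead

end SMB

namespace SMB

open MvPolynomial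

/-- The coordinates of `X = M_{m,n}(K) × M_{n,q}(K)`. -/
abbrev Coord (n m q : ℕ) := (Fin m × Fin n) ⊕ (Fin n × Fin q)

variable {n m q : ℕ}

/-- The weight favouring columns of `U`, and rows of `W`, of small index. -/
def colWeight : Coord n m q → ℕ
  | Sum.inl (_, k) => n - k
  | Sum.inr (k, _) => n - k

/-- The weight singling out the diagonal term of a minor. -/
def diagWeight : Coord n m q → ℕ
  | Sum.inl (a, k) => a * k
  | Sum.inr (k, b) => b * k

variable (n m q) in
/-- The weight of an exponent vector: first by `colWeight`, then by `diagWeight`. -/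
noncomputable def lexWeight : (Coord n m q →₀ ℕ) →+ ℕ ×ₗ ℕ where
  toFun d := toLex (Finsupp.weight colWeight d, Finsupp.weight diagWeight d)
  map_zero' := by simp
  map_add' d e := by rw [map_add, map_add, ← toLex_add, Prod.mk_add_mk]

theorem lexWeight_lt_iff {d e : Coord n m q →₀ ℕ} : lexWeight n m q d < lexWeight n m q e ↔
    Finsupp.weight colWeight d < Finsupp.weight colWeight e ∨
      Finsupp.weight colWeight d = Finsupp.weight colWeight e ∧
        Finsupp.weight diagWeight d < Finsupp.weight diagWeight e :=
  Prod.Lex.toLex_lt_toLex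

/-- The exponent vector of the leading monomial of `polyOf K n m q h`. -/
noncomputable def leadExp : HElt n m q → (Coord n m q →₀ ℕ)
  | Sum.inl I => ∑ c, Finsupp.single (Sum.inl (I.f c, c)) 1
  | Sum.inr (Sum.inl J) => ∑ c, Finsupp.single (Sum.inr (c, J.f c)) 1
  | Sum.inr (Sum.inr P) =>
      ∑ i, (Finsupp.single (Sum.inl (P.val.rows i, Fin.castLE P.2.2 i)) 1 +
        Finsupp.single (Sum.inr (Fin.castLE P.2.2 i, P.val.cols i)) 1)

theorem sum_comp_perm_mul_lt {r N : ℕ} {A : Fin r → Fin N} (hA : StrictMono A)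
    {π : Equiv.Perm (Fin r)} (hπ : π ≠ 1) :
    ∑ i, (A (π i) : ℕ) * (i : ℕ) < ∑ i, (A i : ℕ) * (i : ℕ) := by
  have hmono : Monovary (fun i => (A i : ℕ)) (fun i : Fin r => (i : ℕ)) := by
    intro i j hij
    exact (hA (Fin.lt_def.2 hij)).le
  have h := hmono.sum_comp_perm_mul_lt_sum_mul_iff (σ := π)
  refine h.2 fun hmv => hπ ?_
  have hm : Monotone π := by
    intro i j hij
    rcases hij.eq_or_lt with rfl | hlt
    · exact le_rfl
    · exact hA.le_iff_le.1 (hmv (Fin.lt_def.1 hlt))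
  have hs : StrictMono π := hm.strictMono_of_injective π.injective
  have h2 := Subsingleton.elim (hs.orderIsoOfSurjective π π.surjective) (OrderIso.refl _)
  ext i
  have := congrArg (fun e => e i) h2
  simpa using congrArg Fin.val this

theorem sum_comp_perm_mul_le {r N : ℕ} {A : Fin r → Fin N} (hA : StrictMono A)
    (π : Equiv.Perm (Fin r)) :
    ∑ i, (A (π i) : ℕ) * (i : ℕ) ≤ ∑ i, (A i : ℕ) * (i : ℕ) := by
  by_cases hπ : π = 1
  · simp [hπ]
  · exact (sum_comp_perm_mul_lt hA hπ).le

/-- An injective `r`-tuple is either a rearrangement of `0, …, r - 1` or has a larger sum. -/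
theorem sum_lt_or_exists_perm {r : ℕ} (κ : Fin r → Fin n) (hκ : Function.Injective κ) :
    (∑ i : Fin r, (i : ℕ) < ∑ i, (κ i : ℕ)) ∨
      ∃ ρ : Equiv.Perm (Fin r), ∀ i, (κ (ρ i) : ℕ) = i := by
  set ρ := Tuple.sort κ
  have hs : StrictMono (κ ∘ ρ) :=
    (Tuple.monotone_sort κ).strictMono_of_injective (hκ.comp ρ.injective)
  have hge : ∀ i : Fin r, (i : ℕ) ≤ (κ (ρ i) : ℕ) := by
    rintro ⟨i, hi⟩
    induction i with
    | zero => exact Nat.zero_le _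
    | succ i ih =>
      have h1 := ih (Nat.lt_of_succ_lt hi)
      have h2 : (κ (ρ ⟨i, Nat.lt_of_succ_lt hi⟩) : ℕ) < (κ (ρ ⟨i + 1, hi⟩) : ℕ) :=
        hs (Fin.mk_lt_mk.2 (Nat.lt_succ_self i))
      simp only at h1 ⊢
      omega
  have hsum : ∑ i, (κ i : ℕ) = ∑ i, (κ (ρ i) : ℕ) :=
    (Equiv.sum_comp ρ fun i => (κ i : ℕ)).symm
  by_cases h : ∀ i, (κ (ρ i) : ℕ) = i
  · exact Or.inr ⟨ρ, h⟩
  · left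
    push Not at h
    obtain ⟨i, hi⟩ := h
    rw [hsum]
    exact Finset.sum_lt_sum (fun j _ => hge j)
      ⟨i, Finset.mem_univ i, lt_of_le_of_ne (hge i) (Ne.symm hi)⟩

theorem monomial_sum_single {R σ ι : Type*} [CommRing R] [Fintype ι] (v : ι → σ) (c : R) :
    monomial (∑ i, Finsupp.single (v i) 1) c = C c * ∏ i, (X (v i) : MvPolynomial σ R) :=
  monomial_sum_index _ _ _

/-- Expansion of a minor of a product, one term for each choice of intermediate indices. -/
theorem det_submatrix_mul {R ι α β γ : Type*} [CommRing R] [Fintype ι] [DecidableEq ι]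
    [Fintype β] (M : Matrix α β R) (N : Matrix β γ R) (a : ι → α) (b : ι → γ) :
    (Matrix.of fun i j => (M * N) (a i) (b j)).det =
      ∑ κ : ι → β, (∏ i, N (κ i) (b i)) * (Matrix.of fun i j => M (a i) (κ j)).det := by
  classical
  simp only [Matrix.det_apply', Matrix.of_apply, Matrix.mul_apply, Finset.prod_univ_sum,
    Fintype.piFinset_univ, Finset.mul_sum]
  rw [Finset.sum_comm]
  refine Finset.sum_congr rfl fun κ _ => Finset.sum_congr rfl fun π _ => ?_
  rw [Finset.prod_mul_distrib]
  ring

section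

variable (K : Type) [Field K]

theorem hasLead_uPoly (I : IncTup n m) :
    HasLead (lexWeight n m q) (uPoly K n m q I.f) (leadExp (Sum.inl I)) := by
  have key : uPoly K n m q I.f = ∑ π : Equiv.Perm (Fin n),
      monomial (∑ i, Finsupp.single (Sum.inl (I.f (π i), i)) 1)
        (((Equiv.Perm.sign π : ℤˣ) : ℤ) : K) := by
    rw [uPoly, Matrix.det_apply']
    refine Finset.sum_congr rfl fun π _ => ?_
    rw [monomial_sum_single]
    simp
  rw [key]
  refine hasLead_sum Finset.univ _ (fun π : Equiv.Perm (Fin n) =>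
    ∑ i, Finsupp.single (Sum.inl (I.f (π i), i)) 1) (Finset.mem_univ 1) (by simp)
    fun π _ hπ => ?_
  rw [lexWeight_lt_iff]
  right
  simpa [map_sum, Finsupp.weight_single, colWeight, diagWeight] using sum_comp_perm_mul_lt I.mono hπ

theorem hasLead_xiPoly (J : IncTup n q) :
    HasLead (lexWeight n m q) (xiPoly K n m q J.f) (leadExp (Sum.inr (Sum.inl J))) := by
  have key : xiPoly K n m q J.f = ∑ π : Equiv.Perm (Fin n),
      monomial (∑ i, Finsupp.single (Sum.inr (i, J.f (π i))) 1)
        (((Equiv.Perm.sign π : ℤˣ) : ℤ) : K) := by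
    rw [xiPoly, ← Matrix.det_transpose, Matrix.det_apply']
    refine Finset.sum_congr rfl fun π _ => ?_
    rw [monomial_sum_single]
    simp
  rw [key]
  refine hasLead_sum Finset.univ _ (fun π : Equiv.Perm (Fin n) =>
    ∑ i, Finsupp.single (Sum.inr (i, J.f (π i))) 1) (Finset.mem_univ 1) (by simp)
    fun π _ hπ => ?_
  rw [lexWeight_lt_iff]
  right
  simpa [map_sum, Finsupp.weight_single, colWeight, diagWeight] using sum_comp_perm_mul_lt J.mono hπ

/-- The monomials in the expansion of a minor of `UW`. -/
noncomputable def pTerm (P : PairIx m q) (t : (Fin P.s → Fin n) × Equiv.Perm (Fin P.s)) :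
    Coord n m q →₀ ℕ :=
  ∑ i, (Finsupp.single (Sum.inl (P.rows (t.2 i), t.1 i)) 1 +
    Finsupp.single (Sum.inr (t.1 i, P.cols i)) 1)

theorem pPoly_eq_sum (P : PairIx m q) : pPoly K n m q P =
    ∑ t ∈ (Finset.univ.filter fun κ : Fin P.s → Fin n => Function.Injective κ) ×ˢ
        (Finset.univ : Finset (Equiv.Perm (Fin P.s))),
      monomial (pTerm P t) (((Equiv.Perm.sign t.2 : ℤˣ) : ℤ) : K) := by
  rw [pPoly, det_submatrix_mul, Finset.sum_product, Finset.sum_filter]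
  refine Finset.sum_congr rfl fun κ _ => ?_
  split_ifs with hκ
  · rw [Matrix.det_apply', Finset.mul_sum]
    refine Finset.sum_congr rfl fun π _ => ?_
    rw [pTerm, Finset.sum_add_distrib, ← mul_one (((Equiv.Perm.sign π : ℤˣ) : ℤ) : K),
      ← monomial_mul, monomial_sum_single, monomial_sum_single]
    simp only [Ugen, Wgen, Matrix.of_apply, map_one, one_mul, map_intCast]
    ring
  · obtain ⟨i, j, hij, hne⟩ : ∃ i j, κ i = κ j ∧ i ≠ j := by
      simpa [Function.Injective, and_comm] using hκ
    rw [Matrix.det_zero_of_column_eq hne, mul_zero]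
    intro k
    simp [hij]

theorem pTerm_lt (P : PairIx m q) (hP : P.s ≤ n) {κ : Fin P.s → Fin n}
    (hκ : Function.Injective κ) (π : Equiv.Perm (Fin P.s)) (hne : (κ, π) ≠ (Fin.castLE hP, 1)) :
    lexWeight n m q (pTerm P (κ, π)) < lexWeight n m q (pTerm P (Fin.castLE hP, 1)) := by
  rw [lexWeight_lt_iff]
  simp only [pTerm, map_sum, map_add, Finsupp.weight_single, colWeight, diagWeight, one_smul,
    Fin.val_castLE, Equiv.Perm.coe_one, id_eq]
  rcases sum_lt_or_exists_perm κ hκ with hlt | ⟨ρ, hρ⟩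
  · left
    have h1 : ∑ i, ((n - κ i : ℕ) + (n - κ i : ℕ)) + 2 * ∑ i, (κ i : ℕ) =
        ∑ i : Fin P.s, ((n - i : ℕ) + (n - i : ℕ)) + 2 * ∑ i : Fin P.s, (i : ℕ) := by
      rw [Finset.mul_sum, Finset.mul_sum, ← Finset.sum_add_distrib, ← Finset.sum_add_distrib]
      refine Finset.sum_congr rfl fun i _ => ?_
      have := (κ i).2
      have := i.2
      omega
    omega
  · right
    constructor
    · rw [← Equiv.sum_comp ρ]
      exact Finset.sum_congr rfl fun i _ => by rw [hρ]
    · rw [← Equiv.sum_comp ρ]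
      simp only [hρ, Finset.sum_add_distrib]
      by_cases hρ1 : ρ = 1
      · subst hρ1
        have hκ' : κ = Fin.castLE hP := by
          ext i
          simpa using hρ i
        have hπ : π ≠ 1 := fun hπ => hne (by rw [hκ', hπ])
        exact add_lt_add_of_lt_of_le (sum_comp_perm_mul_lt P.rmono hπ) le_rfl
      · exact add_lt_add_of_le_of_lt (sum_comp_perm_mul_le P.rmono (π * ρ))
          (sum_comp_perm_mul_lt P.cmono hρ1)

theorem hasLead_polyOf (h : HElt n m q) :
    HasLead (lexWeight n m q) (polyOf K n m q h) (leadExp h) := by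
  rcases h with I | J | P
  · exact hasLead_uPoly K I
  · exact hasLead_xiPoly K J
  · rw [polyOf, pPoly_eq_sum]
    have hlead : leadExp (Sum.inr (Sum.inr P)) = pTerm P.val (Fin.castLE P.2.2, 1) := rfl
    rw [hlead]
    refine hasLead_sum _ _ (pTerm P.val) ?_ (by simp) ?_
    · simp [Fin.castLE_injective]
    · rintro ⟨κ, π⟩ hmem hne
      exact pTerm_lt P.val P.2.2 (by simpa using hmem) π hne

end

end SMB

namespace SMB

open MvPolynomial

variable {n m q : ℕ} {K : Type} [Field K]

theorem evalX_pPoly (P : PairIx m q) (U : Matrix (Fin m) (Fin n) K)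
    (W : Matrix (Fin n) (Fin q) K) : evalX K n m q U W (pPoly K n m q P) =
      (Matrix.of fun i j => (U * W) (P.rows i) (P.cols j)).det := by
  rw [pPoly, RingHom.map_det]
  congr 1
  ext i j
  simp [evalX, Ugen, Wgen, Matrix.mul_apply]

theorem evalX_uPoly (I : Fin n → Fin m) (U : Matrix (Fin m) (Fin n) K)
    (W : Matrix (Fin n) (Fin q) K) : evalX K n m q U W (uPoly K n m q I) =
      (U.submatrix I id).det := by
  rw [uPoly, RingHom.map_det]
  congr 1
  ext i j
  simp [evalX]

theorem evalX_xiPoly (J : Fin n → Fin q) (U : Matrix (Fin m) (Fin n) K)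
    (W : Matrix (Fin n) (Fin q) K) : evalX K n m q U W (xiPoly K n m q J) =
      (W.submatrix id J).det := by
  rw [xiPoly, RingHom.map_det]
  congr 1
  ext i j
  simp [evalX]

theorem polyOf_mem_slInvariants (h : HElt n m q) : polyOf K n m q h ∈ slInvariants K n m q := by
  intro A U W
  rcases h with I | J | P
  · simp only [polyOf, evalX_uPoly]
    rw [show (U * (A : Matrix (Fin n) (Fin n) K)).submatrix I.f id =
      U.submatrix I.f id * (A : Matrix (Fin n) (Fin n) K) from rfl, Matrix.det_mul, A.2, mul_one]
  · simp only [polyOf, evalX_xiPoly]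
    rw [show (((A⁻¹ : Matrix.SpecialLinearGroup (Fin n) K) : Matrix (Fin n) (Fin n) K) *
      W).submatrix id J.f = ((A⁻¹ : Matrix.SpecialLinearGroup (Fin n) K) :
        Matrix (Fin n) (Fin n) K) * W.submatrix id J.f from rfl, Matrix.det_mul, (A⁻¹).2, one_mul]
  · simp only [polyOf, evalX_pPoly]
    have hA : (A : Matrix (Fin n) (Fin n) K) *
        ((A⁻¹ : Matrix.SpecialLinearGroup (Fin n) K) : Matrix (Fin n) (Fin n) K) = 1 := by
      rw [← Matrix.SpecialLinearGroup.coe_mul, mul_inv_cancel, Matrix.SpecialLinearGroup.coe_one]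
    rw [Matrix.mul_assoc, ← Matrix.mul_assoc (A : Matrix (Fin n) (Fin n) K), hA, Matrix.one_mul]

/-- The point `(UA, BW)`, in coordinates, for the point `(U, W)` with coordinates `p`. -/
def actPoint (A B : Matrix (Fin n) (Fin n) K) (p : Coord n m q → K) : Coord n m q → K
  | Sum.inl (a, k) => ∑ l, p (Sum.inl (a, l)) * A l k
  | Sum.inr (k, b) => ∑ l, B k l * p (Sum.inr (l, b))

theorem IsSLInvariant.eval_actPoint {f : KX K n m q} (hf : IsSLInvariant f)
    {A B : Matrix (Fin n) (Fin n) K} (hdet : A.det = 1) (hAB : A * B = 1)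
    (p : Coord n m q → K) : eval (actPoint A B p) f = eval p f := by
  let S : Matrix.SpecialLinearGroup (Fin n) K := ⟨A, hdet⟩
  have hB : ((S⁻¹ : Matrix.SpecialLinearGroup (Fin n) K) : Matrix (Fin n) (Fin n) K) = B := by
    have h1 : ((S⁻¹ : Matrix.SpecialLinearGroup (Fin n) K) : Matrix (Fin n) (Fin n) K) * A = 1 := by
      have := congrArg (fun M : Matrix.SpecialLinearGroup (Fin n) K =>
        (M : Matrix (Fin n) (Fin n) K)) (inv_mul_cancel S)
      simpa only [Matrix.SpecialLinearGroup.coe_mul, Matrix.SpecialLinearGroup.coe_one] using this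
    calc _ = _ * (A * B) := by rw [hAB, Matrix.mul_one]
      _ = B := by rw [← Matrix.mul_assoc, h1, Matrix.one_mul]
  have h := hf S (Matrix.of fun a k => p (Sum.inl (a, k))) (Matrix.of fun k b => p (Sum.inr (k, b)))
  rw [hB] at h
  simp only [evalX] at h
  have h1 : (Sum.elim (fun x => ((Matrix.of fun a k => p (Sum.inl (a, k))) *
      (S : Matrix (Fin n) (Fin n) K)) x.1 x.2)
      (fun x => (B * Matrix.of fun k b => p (Sum.inr (k, b))) x.1 x.2) : Coord n m q → K) =
      actPoint A B p := by
    funext i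
    rcases i with ⟨a, k⟩ | ⟨k, b⟩ <;> simp [actPoint, Matrix.mul_apply, S]
  have h2 : (Sum.elim (fun x => (Matrix.of fun a k => p (Sum.inl (a, k))) x.1 x.2)
      (fun x => (Matrix.of fun k b => p (Sum.inr (k, b))) x.1 x.2) : Coord n m q → K) = p := by
    funext i
    rcases i with ⟨a, k⟩ | ⟨k, b⟩ <;> simp
  rwa [h1, h2] at h

theorem eval_aeval {σ τ : Type*} (g : τ → MvPolynomial σ K) (p : σ → K) (f : MvPolynomial τ K) :
    eval p (aeval g f) = eval (fun i => eval p (g i)) f := by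
  induction f using MvPolynomial.induction_on <;> simp_all

theorem coeff_aeval_C_mul_X {σ : Type*} (c : σ → K) (f : MvPolynomial σ K) (d : σ →₀ ℕ) :
    coeff d (aeval (fun i => C (c i) * X i : σ → MvPolynomial σ K) f) =
      (d.prod fun i k => c i ^ k) * coeff d f := by
  classical
  induction f using MvPolynomial.induction_on' with
  | monomial e a =>
    have : aeval (fun i => C (c i) * X i : σ → MvPolynomial σ K) (monomial e a) =
        monomial e (a * e.prod fun i k => c i ^ k) := by
      rw [aeval_monomial, monomial_eq, C_mul, mul_assoc]
      congr 1
      simp only [mul_pow, Finsupp.prod, Finset.prod_mul_distrib, map_prod, map_pow]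
    rw [this, coeff_monomial, coeff_monomial]
    split_ifs with h
    · rw [h, mul_comm]
    · simp
  | add f g hf hg => rw [map_add, coeff_add, hf, hg, coeff_add, mul_add]

theorem infinite_ne_zero [Infinite K] : {s : K | s ≠ 0}.Infinite :=
  (Set.finite_singleton (0 : K)).infinite_compl

theorem eq_of_forall_pow_eq_pow [Infinite K] {k l : ℕ} (h : ∀ s : K, s ≠ 0 → s ^ k = s ^ l) :
    k = l := by
  have hp : (Polynomial.X ^ k : Polynomial K) = Polynomial.X ^ l :=
    Polynomial.eq_of_infinite_eval_eq _ _ (infinite_ne_zero.mono fun s hs => by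
      simpa using h s hs)
  simpa using congrArg Polynomial.natDegree hp

/-- Torus invariance: the number of variables in column `c` of `U` minus the number of
variables in row `c` of `W` does not depend on `c`. -/
theorem IsSLInvariant.column_sum_eq [Infinite K] {f : KX K n m q} (hf : IsSLInvariant f)
    {d : Coord n m q →₀ ℕ} (hd : coeff d f ≠ 0) {c c' : Fin n} (hc : c ≠ c') :
    ∑ a, d (Sum.inl (a, c)) + ∑ b, d (Sum.inr (c', b)) =
      ∑ a, d (Sum.inl (a, c')) + ∑ b, d (Sum.inr (c, b)) := by
  refine eq_of_forall_pow_eq_pow (K := K) fun s hs => ?_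
  let δ : Fin n → K := fun k => if k = c then s else if k = c' then s⁻¹ else 1
  have hδ0 : ∀ k, δ k ≠ 0 := by
    intro k
    simp only [δ]
    split_ifs <;> simp [hs]
  let r : Coord n m q → K := Sum.elim (fun x => δ x.2) (fun x => (δ x.1)⁻¹)
  have hact : ∀ p, actPoint (Matrix.diagonal δ) (Matrix.diagonal fun k => (δ k)⁻¹) p =
      fun i => r i * p i := by
    intro p
    funext i
    rcases i with ⟨a, k⟩ | ⟨k, b⟩
    · simp [actPoint, r, Matrix.diagonal_apply, mul_comm]
    · simp [actPoint, r, Matrix.diagonal_apply]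
  have hdet : (Matrix.diagonal δ).det = 1 := by
    rw [Matrix.det_diagonal, Fintype.prod_eq_mul c c' hc]
    · simp [δ, hc.symm, hs]
    · rintro x ⟨h1, h2⟩
      simp [δ, h1, h2]
  have hAB : Matrix.diagonal δ * (Matrix.diagonal fun k => (δ k)⁻¹) = 1 := by
    rw [Matrix.diagonal_mul_diagonal, ← Matrix.diagonal_one]
    congr 1
    funext k
    exact mul_inv_cancel₀ (hδ0 k)
  have hpoly : aeval (fun i => C (r i) * X i : Coord n m q → KX K n m q) f = f := by
    refine MvPolynomial.funext fun p => ?_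
    rw [← hf.eval_actPoint hdet hAB p, hact, eval_aeval]
    simp
  have h1 : (d.prod fun i k => r i ^ k) = 1 := by
    have := coeff_aeval_C_mul_X r f d
    rw [hpoly] at this
    exact mul_right_cancel₀ hd (by rw [one_mul]; exact this.symm)
  rw [Finsupp.prod_fintype _ _ (by simp), Fintype.prod_sum_type, Fintype.prod_prod_type_right,
    Fintype.prod_prod_type] at h1
  simp only [r, Sum.elim_inl, Sum.elim_inr, Finset.prod_pow_eq_pow_sum] at h1
  rw [Fintype.prod_eq_mul c c' hc, Fintype.prod_eq_mul c c' hc] at h1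
  · simp only [δ, if_true, hc.symm, if_false, inv_inv] at h1
    rw [inv_pow, inv_pow] at h1
    rw [pow_add, pow_add]
    field_simp at h1
    exact h1
  all_goals
    rintro x ⟨h1, h2⟩
    simp [δ, h1, h2]

/-- The part of `f` of maximal weight `N` is invariant under adding column `c` of `U` to column
`c + 1`. -/
theorem IsSLInvariant.aeval_top [Infinite K] {f : KX K n m q} (hf : IsSLInvariant f) {N : ℕ}
    (hN : ∀ d, coeff d f ≠ 0 → Finsupp.weight colWeight d ≤ N) {c c' : Fin n}
    (hc : (c' : ℕ) = c + 1) :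
    aeval (Sum.elim
        (fun x => if x.2 = c' then X (Sum.inl x) + X (Sum.inl (x.1, c)) else X (Sum.inl x))
        (fun x => X (Sum.inr x)) : Coord n m q → KX K n m q)
      (weightedHomogeneousComponent colWeight N f) = weightedHomogeneousComponent colWeight N f := by
  classical
  have hcc : c ≠ c' := fun h => by rw [h] at hc; omega
  refine MvPolynomial.funext fun p => ?_
  -- the rescaled polynomial, as a function of the scaling parameter
  let F : (Coord n m q → Polynomial K) → Polynomial K := fun P =>
    ∑ d ∈ f.support, Polynomial.C (coeff d f) *
      Polynomial.X ^ (N - Finsupp.weight colWeight d) * ∏ i, P i ^ d i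
  let Q : Coord n m q → Polynomial K := Sum.elim
    (fun x => if x.2 = c' then Polynomial.C (p (Sum.inl x)) + Polynomial.C (p (Sum.inl (x.1, c)))
      else Polynomial.C (p (Sum.inl x)))
    (fun x => if x.1 = c then Polynomial.C (p (Sum.inr x)) -
      Polynomial.X ^ 2 * Polynomial.C (p (Sum.inr (c', x.2))) else Polynomial.C (p (Sum.inr x)))
  have hF : ∀ (P : Coord n m q → Polynomial K) (ε : K), ε ≠ 0 →
      (F P).eval ε = ε ^ N * eval (fun i => ε⁻¹ ^ (colWeight i) * (P i).eval ε) f := by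
    intro P ε hε
    simp only [F]
    rw [Polynomial.eval_finsetSum, eval_eq', Finset.mul_sum]
    refine Finset.sum_congr rfl fun d hd => ?_
    have hdN := hN d (mem_support_iff.1 hd)
    simp only [Polynomial.eval_mul, Polynomial.eval_C, Polynomial.eval_pow, Polynomial.eval_X,
      Polynomial.eval_prod, mul_pow, Finset.prod_mul_distrib]
    have hw : ∏ i, (ε⁻¹ ^ colWeight i) ^ d i = ε⁻¹ ^ Finsupp.weight colWeight d := by
      rw [Finsupp.weight_eq_sum, ← Finset.prod_pow_eq_pow_sum]
      refine Finset.prod_congr rfl fun i _ => ?_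
      rw [← pow_mul, smul_eq_mul, mul_comm]
    rw [hw, pow_sub₀ ε hε hdN, inv_pow]
    ring
  have hF0 : ∀ P : Coord n m q → Polynomial K, (F P).eval 0 =
      eval (fun i => (P i).eval 0) (weightedHomogeneousComponent colWeight N f) := by
    intro P
    simp only [F]
    rw [Polynomial.eval_finsetSum, weightedHomogeneousComponent_apply, map_sum, Finset.sum_filter]
    refine Finset.sum_congr rfl fun d hd => ?_
    have hdN := hN d (mem_support_iff.1 hd)
    split_ifs with h
    · simp [h, eval_monomial, Polynomial.eval_prod, Finsupp.prod_fintype]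
    · have : N - Finsupp.weight colWeight d ≠ 0 := by omega
      simp [this]
  have hpoly : F Q = F fun i => Polynomial.C (p i) := by
    refine Polynomial.eq_of_infinite_eval_eq _ _ (infinite_ne_zero.mono fun ε hε => ?_)
    have hε : ε ≠ 0 := hε
    simp only [Set.mem_ofPred_eq, hF _ ε hε, Polynomial.eval_C]
    congr 1
    have hAB : Matrix.transvection c c' ε * Matrix.transvection c c' (-ε) = 1 := by
      rw [Matrix.transvection_mul_transvection_same _ _ hcc, add_neg_cancel,
        Matrix.transvection_zero]
    refine Eq.trans ?_ (hf.eval_actPoint (Matrix.det_transvection_of_ne c c' hcc ε) hAB _)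
    have hw : n - (c : ℕ) = (n - c') + 1 := by
      have := c'.2
      omega
    congr 2
    funext i
    rcases i with ⟨a, k⟩ | ⟨k, b⟩
    · by_cases hk : k = c'
      · subst hk
        simp [actPoint, Q, Matrix.transvection, Matrix.add_apply, Matrix.one_apply,
          Matrix.single_apply, mul_add, Finset.sum_add_distrib, colWeight, hw, pow_succ]
        field_simp
      · simp [actPoint, Q, Matrix.transvection, Matrix.add_apply, Matrix.one_apply,
          colWeight, hk, Ne.symm hk]
    · by_cases hk : k = c
      · subst hk
        simp [actPoint, Q, Matrix.transvection, Matrix.add_apply, Matrix.one_apply,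
          Matrix.single_apply, add_mul, Finset.sum_add_distrib, colWeight, hw, pow_succ]
        field_simp
        ring
      · simp [actPoint, Q, Matrix.transvection, Matrix.add_apply, Matrix.one_apply,
          colWeight, hk, Ne.symm hk]
  have h0 := congrArg (Polynomial.eval 0) hpoly
  rw [hF0, hF0] at h0
  simp only [Polynomial.eval_C] at h0
  rw [eval_aeval, ← h0]
  congr 1
  congr 1
  funext i
  rcases i with ⟨a, k⟩ | ⟨k, b⟩
  · by_cases hk : k = c' <;> simp [Q, hk]
  · by_cases hk : k = c <;> simp [Q, hk]

end SMB

namespace SMB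

open MvPolynomial

variable {n m q : ℕ} {K : Type} [Field K]

theorem sum_coord_eq_of_two_columns {M : Type*} [AddCommMonoid M] {c c' : Fin n} (hcc : c ≠ c')
    {g : Coord n m q → M} (hl : ∀ x k, k ≠ c → k ≠ c' → g (Sum.inl (x, k)) = 0)
    (hr : ∀ i, g (Sum.inr i) = 0) :
    ∑ i, g i = ∑ x, (g (Sum.inl (x, c)) + g (Sum.inl (x, c'))) := by
  rw [Fintype.sum_sum_type, Finset.sum_eq_zero fun i _ => hr i, add_zero, Fintype.sum_prod_type]
  exact Finset.sum_congr rfl fun x _ => Fintype.sum_eq_add c c' hcc fun k hk => hl x k hk.1 hk.2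

theorem weight_mapDomain {σ τ M : Type*} [AddCommMonoid M] (w : τ → M) (μ : σ → τ)
    (d : σ →₀ ℕ) : Finsupp.weight w (d.mapDomain μ) = Finsupp.weight (w ∘ μ) d := by
  rw [Finsupp.weight_apply, Finsupp.weight_apply, Finsupp.sum_mapDomain_index]
  · rfl
  · simp
  · intros; rw [add_smul]

section Shear

/-- `d` and `e` differ only by moving variables between columns `c` and `c'` of `U`, within the
same row. -/
structure SameRows (c c' : Fin n) (d e : Coord n m q →₀ ℕ) : Prop where
  left : ∀ x k, k ≠ c → k ≠ c' → d (Sum.inl (x, k)) = e (Sum.inl (x, k))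
  right : ∀ i, d (Sum.inr i) = e (Sum.inr i)
  row : ∀ x, d (Sum.inl (x, c)) + d (Sum.inl (x, c')) = e (Sum.inl (x, c)) + e (Sum.inl (x, c'))

theorem SameRows.weight_sub {c c' : Fin n} (hcc : c ≠ c') {d e : Coord n m q →₀ ℕ}
    (h : SameRows c c' d e) (w : Coord n m q → ℕ) :
    (Finsupp.weight w d : ℤ) - Finsupp.weight w e =
      ∑ x, ((d (Sum.inl (x, c')) : ℤ) - e (Sum.inl (x, c'))) *
        ((w (Sum.inl (x, c')) : ℤ) - w (Sum.inl (x, c))) := by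
  rw [Finsupp.weight_eq_sum, Finsupp.weight_eq_sum]
  push_cast
  rw [← Finset.sum_sub_distrib, sum_coord_eq_of_two_columns hcc]
  · refine Finset.sum_congr rfl fun x _ => ?_
    have := h.row x
    have h2 : (d (Sum.inl (x, c)) : ℤ) = e (Sum.inl (x, c)) + e (Sum.inl (x, c')) -
      d (Sum.inl (x, c')) := by omega
    simp only [smul_eq_mul, Nat.cast_mul, h2]
    ring
  · intro x k hk hk'
    rw [h.left x k hk hk', sub_self]
  · intro i
    rw [h.right i, sub_self]

variable (K) in
/-- The substitution adding column `c` of `U` to column `c'`, followed by `shearNeg`. -/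
noncomputable def shearPos (c c' : Fin n) (a : Fin m) : Coord n m q → KX K n m q
  | Sum.inl (x, k) =>
    if k = c then
      if x < a then X (Sum.inl (x, c)) + X (Sum.inl (x, c')) else X (Sum.inl (x, c))
    else if k = c' then
      if x < a then X (Sum.inl (x, c')) else
        if x = a then X (Sum.inl (x, c)) else X (Sum.inl (x, c')) + X (Sum.inl (x, c))
    else X (Sum.inl (x, k))
  | Sum.inr i => X (Sum.inr i)

variable (K) in
/-- A substitution mixing columns `c` and `c'` of `U`, which depends on a row `a`. -/
noncomputable def shearNeg (c c' : Fin n) (a : Fin m) : Coord n m q → KX K n m q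
  | Sum.inl (x, k) =>
    if k = c then
      if x < a then X (Sum.inl (x, c)) + X (Sum.inl (x, c')) else X (Sum.inl (x, c))
    else if k = c' then
      if x < a then -X (Sum.inl (x, c)) else if x = a then 0 else X (Sum.inl (x, c'))
    else X (Sum.inl (x, k))
  | Sum.inr i => X (Sum.inr i)

/-- The effect of `shearPos` on leading variables. -/
def shearLead (c c' : Fin n) (a : Fin m) (i : Coord n m q) : Coord n m q :=
  if i = Sum.inl (a, c') then Sum.inl (a, c) else i

/-- The weight with respect to which `shearPos` has leading variables `shearLead`. -/
def shearWeight (c c' : Fin n) (a : Fin m) : Coord n m q → ℕ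
  | Sum.inl (x, k) => if k = c then a - x else if k = c' then x - a else 0
  | Sum.inr _ => 0

theorem aeval_shearNeg_comp {c c' : Fin n} (hcc : c ≠ c') (a : Fin m) (h : KX K n m q) :
    aeval (shearNeg K c c' a) (aeval (Sum.elim
        (fun x => if x.2 = c' then X (Sum.inl x) + X (Sum.inl (x.1, c)) else X (Sum.inl x))
        (fun x => X (Sum.inr x)) : Coord n m q → KX K n m q) h) =
      aeval (shearPos K c c' a) h := by
  rw [← AlgHom.comp_apply]
  congr 1
  refine algHom_ext fun i => ?_
  rcases i with ⟨x, k⟩ | i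
  · by_cases hk : k = c'
    · subst hk
      rcases lt_trichotomy x a with hx | hx | hx
      · simp [shearNeg, shearPos, hcc.symm, hx]
      · simp [shearNeg, shearPos, hcc.symm, hx]
      · simp [shearNeg, shearPos, hcc.symm, hx.not_gt, hx.ne']
    · simp [shearNeg, shearPos, hk]
  · simp [shearNeg, shearPos]

theorem hasLead_shearPos {c c' : Fin n} (hcc : c ≠ c') (a : Fin m) (i : Coord n m q) :
    HasLead (Finsupp.weight (shearWeight c c' a)) (shearPos K c c' a i)
      (Finsupp.single (shearLead c c' a i) 1) := by
  have hX : ∀ i, HasLead (Finsupp.weight (shearWeight c c' a)) (X i : KX K n m q)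
      (Finsupp.single i 1) := fun i => hasLead_monomial _
  have hXX : ∀ i j, (shearWeight c c' a j < shearWeight c c' a i) →
      HasLead (Finsupp.weight (shearWeight c c' a)) (X i + X j : KX K n m q)
        (Finsupp.single i 1) := by
    intro i j hij
    have := hasLead_sum (wt := Finsupp.weight (shearWeight c c' a)) (Finset.univ : Finset (Fin 2))
      (fun _ => (1 : K)) ![Finsupp.single i 1, Finsupp.single j 1] (Finset.mem_univ 0) rfl (by
        intro k _ hk
        have : k = 1 := by omega
        subst this
        simpa [Finsupp.weight_single] using hij)
    rw [Fin.sum_univ_two] at this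
    exact this
  rcases i with ⟨x, k⟩ | i
  · by_cases hk : k = c
    · subst hk
      by_cases hx : x < a
      · simp only [shearPos, if_true, hx, shearLead, Sum.inl.injEq, Prod.mk.injEq, hcc, and_false,
          if_false]
        exact hXX _ _ (by simp [shearWeight, hcc.symm]; omega)
      · simp only [shearPos, if_true, hx, shearLead, Sum.inl.injEq, Prod.mk.injEq, hcc, and_false,
          if_false]
        exact hX _
    · by_cases hk' : k = c'
      · subst hk'
        rcases lt_trichotomy x a with hx | hx | hx
        · simp only [shearPos, hk, if_true, if_false, hx, shearLead, Sum.inl.injEq, Prod.mk.injEq,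
            hx.ne, false_and]
          exact hX _
        · simp only [shearPos, hk, if_true, if_false, hx, shearLead, lt_irrefl]
          exact hX _
        · simp only [shearPos, hk, if_true, if_false, hx.not_gt, shearLead, Sum.inl.injEq,
            Prod.mk.injEq, hx.ne', false_and]
          exact hXX _ _ (by simp [shearWeight, hcc.symm]; omega)
      · simp only [shearPos, hk, hk', if_false, shearLead, Sum.inl.injEq, Prod.mk.injEq, and_false]
        exact hX _
  · simp only [shearPos, shearLead, reduceCtorEq, if_false]
    exact hX _

theorem isWeightedHomogeneous_shear {c c' : Fin n} (a : Fin m) {w : Coord n m q → ℕ}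
    (hw : ∀ x, w (Sum.inl (x, c)) = w (Sum.inl (x, c'))) (i : Coord n m q) :
    IsWeightedHomogeneous w (shearPos K c c' a i) (w i) ∧
      IsWeightedHomogeneous w (shearNeg K c c' a i) (w i) := by
  have hX : ∀ i, IsWeightedHomogeneous w (X i : KX K n m q) (w i) :=
    isWeightedHomogeneous_X K w
  have hX' : ∀ x, IsWeightedHomogeneous w (X (Sum.inl (x, c)) : KX K n m q)
      (w (Sum.inl (x, c'))) := fun x => hw x ▸ hX _
  have hX'' : ∀ x, IsWeightedHomogeneous w (X (Sum.inl (x, c')) : KX K n m q)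
      (w (Sum.inl (x, c))) := fun x => (hw x).symm ▸ hX _
  have hneg : ∀ {f : KX K n m q} {k}, IsWeightedHomogeneous w f k →
      IsWeightedHomogeneous w (-f) k := fun hf => by
    simpa using hf.C_mul (-1)
  rcases i with ⟨x, k⟩ | i
  · simp only [shearPos, shearNeg]
    split_ifs with h1 h2 h3 h4 h5
    all_goals try subst h1
    all_goals try subst h3
    · exact ⟨(hX _).add (hX'' _), (hX _).add (hX'' _)⟩
    · exact ⟨hX _, hX _⟩
    · exact ⟨hX _, hneg (hX' _)⟩
    · exact ⟨hX' _, isWeightedHomogeneous_zero _ _ _⟩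
    · exact ⟨(hX _).add (hX' _), hX _⟩
    · exact ⟨hX _, hX _⟩
  · exact ⟨hX _, hX _⟩

theorem sameRows_of_weight_eq {c c' : Fin n} {d e : Coord n m q →₀ ℕ} (hcc : c ≠ c')
    (h : ∀ w : Coord n m q → ℕ, (∀ x, w (Sum.inl (x, c)) = w (Sum.inl (x, c'))) →
      Finsupp.weight w d = Finsupp.weight w e) : SameRows c c' d e := by
  classical
  have hsingle : ∀ (j : Coord n m q) (d : Coord n m q →₀ ℕ),
      Finsupp.weight (Pi.single j 1) d = d j := fun j d => by
    simp [Finsupp.weight_eq_sum, Pi.single_apply]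
  refine ⟨fun x k hk hk' => ?_, fun i => ?_, fun x => ?_⟩
  · have := h (Pi.single (Sum.inl (x, k)) 1) (by simp [hk.symm, hk'.symm])
    rwa [hsingle, hsingle] at this
  · have := h (Pi.single (Sum.inr i) 1) (by simp)
    rwa [hsingle, hsingle] at this
  · have := h (Pi.single (Sum.inl (x, c)) 1 + Pi.single (Sum.inl (x, c')) 1)
      (by intro y; simp [Pi.single_apply, hcc, hcc.symm])
    have hadd : ∀ d : Coord n m q →₀ ℕ, Finsupp.weight
        (Pi.single (Sum.inl (x, c)) 1 + Pi.single (Sum.inl (x, c')) 1 : Coord n m q → ℕ) d =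
        d (Sum.inl (x, c)) + d (Sum.inl (x, c')) := by
      intro d
      rw [← hsingle, ← hsingle]
      simp only [Finsupp.weight_eq_sum, Pi.add_apply, smul_add, Finset.sum_add_distrib]
    rwa [hadd, hadd] at this

/-- The lattice-word inequality on leading monomials of invariants, for `U`. -/
theorem IsSLInvariant.sum_Iic_le [Infinite K] {f : KX K n m q} (hf : IsSLInvariant f)
    {e : Coord n m q →₀ ℕ} (he : coeff e f ≠ 0)
    (hmax : ∀ d, coeff d f ≠ 0 → lexWeight n m q d ≤ lexWeight n m q e) {c c' : Fin n}
    (hc : (c' : ℕ) = c + 1) (a : Fin m) :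
    ∑ x ∈ Finset.Iic a, e (Sum.inl (x, c')) ≤ ∑ x ∈ Finset.Iio a, e (Sum.inl (x, c)) := by
  classical
  have hcc : c ≠ c' := fun h => by rw [h] at hc; omega
  set h := weightedHomogeneousComponent colWeight (Finsupp.weight colWeight e) f with hdef
  have hcoeff : ∀ d, coeff d h ≠ 0 → coeff d f ≠ 0 ∧
      Finsupp.weight colWeight d = Finsupp.weight colWeight e := by
    intro d hd
    rw [hdef, coeff_weightedHomogeneousComponent] at hd
    split_ifs at hd with hw
    · exact ⟨hd, hw⟩
    · exact absurd rfl hd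
  have heh : coeff e h ≠ 0 := by
    rwa [hdef, coeff_weightedHomogeneousComponent, if_pos rfl]
  have htop := hf.aeval_top (N := Finsupp.weight colWeight e) (fun d hd => by
    by_contra hlt
    exact (hmax d hd).not_gt (lexWeight_lt_iff.2 (Or.inl (not_le.1 hlt)))) hc
  have hshear : aeval (shearPos K c c' a) h = aeval (shearNeg K c c' a) h := by
    rw [← aeval_shearNeg_comp hcc, htop]
  have hlead := hasLead_aeval_monomial (hasLead_shearPos (K := K) (q := q) hcc a)
  set M := e.mapDomain (shearLead c c' a) with hM
  have hwM : ∀ w : Coord n m q → ℕ, (∀ x, w (Sum.inl (x, c)) = w (Sum.inl (x, c'))) →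
      Finsupp.weight w M = Finsupp.weight w e := fun w hw =>
    isWeightedHomogeneous_aeval_monomial (R := K)
      (fun i => (isWeightedHomogeneous_shear a hw i).1) e (by rw [(hlead e).1]; exact one_ne_zero)
  -- the column `c'` has the same total degree in all relevant monomials
  have hsum : ∀ d, coeff d h ≠ 0 → SameRows c c' d e →
      ∑ x, ((d (Sum.inl (x, c')) : ℤ) - e (Sum.inl (x, c'))) = 0 := by
    intro d hd hs
    have h1 := hs.weight_sub hcc colWeight
    rw [(hcoeff d hd).2, sub_self] at h1
    have h2 : ∀ x : Fin m, ((colWeight (Sum.inl (x, c') : Coord n m q) : ℤ) -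
        colWeight (Sum.inl (x, c) : Coord n m q)) = -1 := by
      intro x
      have := c'.2
      simp only [colWeight]
      omega
    simp only [h2, mul_neg, mul_one, Finset.sum_neg_distrib] at h1
    omega
  have hne : coeff M (aeval (shearPos K c c' a) h) ≠ 0 := by
    rw [coeff_aeval_eq_sum, Finset.sum_eq_single e, (hlead e).1, mul_one]
    · exact heh
    · intro d hd hde
      rw [mem_support_iff] at hd
      by_contra hcon
      replace hcon := right_ne_zero_of_mul hcon
      have hs : SameRows c c' d e := sameRows_of_weight_eq hcc fun w hw =>
        (isWeightedHomogeneous_aeval_monomial (R := K)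
          (fun i => (isWeightedHomogeneous_shear a hw i).1) d hcon).symm.trans (hwM w hw)
      have hsum0 := hsum d hd hs
      by_cases hMd : M = d.mapDomain (shearLead c c' a)
      · have hx : ∀ x, x ≠ a → d (Sum.inl (x, c')) = e (Sum.inl (x, c')) := by
          intro x hx
          have h1 := congrArg (Finsupp.weight (Pi.single (Sum.inl (x, c')) 1)) hMd
          have h2 : (Pi.single (Sum.inl (x, c')) 1 : Coord n m q → ℕ) ∘ shearLead c c' a =
              Pi.single (Sum.inl (x, c')) 1 := by
            funext i
            simp only [Function.comp, shearLead, Pi.single_apply]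
            split_ifs <;> simp_all
          rw [hM, weight_mapDomain, weight_mapDomain, h2] at h1
          simpa [Finsupp.weight_eq_sum, Pi.single_apply] using h1.symm
        have hxa : d (Sum.inl (a, c')) = e (Sum.inl (a, c')) := by
          rw [Finset.sum_eq_single a] at hsum0
          · omega
          · intro x _ hxa
            rw [hx x hxa, sub_self]
          · simp
        apply hde
        ext i
        rcases i with ⟨x, k⟩ | i
        · have hx' : d (Sum.inl (x, c')) = e (Sum.inl (x, c')) := by
            by_cases hxa' : x = a
            · rw [hxa', hxa]
            · exact hx x hxa'
          by_cases hk' : k = c'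
          · rw [hk', hx']
          · by_cases hk : k = c
            · have := hs.row x
              rw [hk]
              omega
            · exact hs.left x k hk hk'
        · exact hs.right i
      · have hlt := (hlead d).2 M hcon hMd
        rw [hM, weight_mapDomain, weight_mapDomain] at hlt
        have h1 := hs.weight_sub hcc (shearWeight c c' a ∘ shearLead c c' a)
        have h2 : ∀ x : Fin m,
            (((shearWeight c c' a ∘ shearLead c c' a) (Sum.inl (x, c') : Coord n m q) : ℕ) : ℤ) -
              ((shearWeight c c' a ∘ shearLead c c' a) (Sum.inl (x, c) : Coord n m q) : ℕ) =
              x - a := by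
          intro x
          by_cases hx : x = a
          · simp [shearWeight, shearLead, hx, hcc]
          · simp [shearWeight, shearLead, hx, hcc, hcc.symm]
            omega
        have h3 := hs.weight_sub hcc diagWeight
        have h4 : ∀ x : Fin m, ((diagWeight (Sum.inl (x, c') : Coord n m q) : ℤ) -
            diagWeight (Sum.inl (x, c) : Coord n m q)) = x := by
          intro x
          simp only [diagWeight, hc]
          push_cast
          ring
        have h5 : ∑ x, ((d (Sum.inl (x, c')) : ℤ) - e (Sum.inl (x, c'))) * ((x : ℤ) - a) =
            ∑ x, ((d (Sum.inl (x, c')) : ℤ) - e (Sum.inl (x, c'))) * (x : ℤ) := by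
          simp only [mul_sub _ _ (a : ℤ), Finset.sum_sub_distrib _ (fun x => _ * (a : ℤ)),
            ← Finset.sum_mul, hsum0, zero_mul, sub_zero]
        simp only [h2] at h1
        simp only [h4] at h3
        refine (hmax d (hcoeff d hd).1).not_gt (lexWeight_lt_iff.2 (Or.inr ⟨(hcoeff d hd).2.symm, ?_⟩))
        omega
    · intro hn
      exact absurd (mem_support_iff.2 heh) hn
  rw [hshear, coeff_aeval_eq_sum] at hne
  obtain ⟨d, hd, hcon⟩ := Finset.exists_ne_zero_of_sum_ne_zero hne
  rw [mem_support_iff] at hd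
  replace hcon := right_ne_zero_of_mul hcon
  have hs : SameRows c c' d e := sameRows_of_weight_eq hcc fun w hw =>
    (isWeightedHomogeneous_aeval_monomial (R := K)
      (fun i => (isWeightedHomogeneous_shear a hw i).2) d hcon).symm.trans (hwM w hw)
  let v : Coord n m q → ℕ := Sum.elim (fun x => if x.2 = c' then 1 else 0) 0
  let l : Coord n m q → ℕ := Sum.elim (fun x => if x.2 = c ∧ x.1 < a ∨ x.2 = c' ∧ a < x.1 then 1
    else 0) 0
  have hle : Finsupp.weight v d ≤ Finsupp.weight l M := by
    refine weight_le_of_coeff_aeval_monomial_ne_zero (R := K) (fun i g hg => ?_) d hcon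
    rcases i with ⟨x, k⟩ | i
    · by_cases hk : k = c'
      · subst hk
        rcases lt_trichotomy x a with hx | hx | hx
        · simp only [shearNeg, hcc.symm, if_true, if_false, hx, coeff_neg, coeff_X, ne_eq,
            neg_eq_zero] at hg
          have : Finsupp.single (Sum.inl (x, c)) 1 = g := by
            by_contra hcon
            exact hg (if_neg hcon)
          simp [← this, Finsupp.weight_single, v, l, hx]
        · simp [shearNeg, hcc.symm, hx] at hg
        · simp only [shearNeg, hcc.symm, if_true, if_false, hx.not_gt, hx.ne', coeff_X, ne_eq]
            at hg
          have : Finsupp.single (Sum.inl (x, k)) 1 = g := by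
            by_contra hcon
            exact hg (if_neg hcon)
          simp [← this, Finsupp.weight_single, v, l, hx]
      · simp [v, hk]
    · simp [v]
  have hv := hs.weight_sub hcc v
  have h2 : ∀ x : Fin m, ((v (Sum.inl (x, c') : Coord n m q) : ℤ) -
      v (Sum.inl (x, c) : Coord n m q)) = 1 := by
    intro x
    simp [v, hcc]
  simp only [h2, mul_one, hsum d hd hs] at hv
  have hve : Finsupp.weight v e = ∑ x, e (Sum.inl (x, c')) := by
    rw [Finsupp.weight_eq_sum, sum_coord_eq_of_two_columns hcc]
    · simp [v, hcc]
    · intro x k _ hk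
      simp [v, hk]
    · simp [v]
  have hle' : Finsupp.weight l M = ∑ x, (if x < a then e (Sum.inl (x, c)) else 0) +
      ∑ x, if a < x then e (Sum.inl (x, c')) else 0 := by
    rw [hM, weight_mapDomain, Finsupp.weight_eq_sum, sum_coord_eq_of_two_columns hcc,
      Finset.sum_add_distrib]
    · congr 1
      · refine Finset.sum_congr rfl fun x _ => ?_
        simp [l, shearLead, hcc]
      · refine Finset.sum_congr rfl fun x _ => ?_
        by_cases hx : x = a
        · simp [l, shearLead, hcc, hx]
        · simp [l, shearLead, hcc.symm, hx]
    · intro x k hk hk'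
      simp [l, shearLead, hk, hk']
    · simp [l, shearLead]
  have hsplit : ∑ x, e (Sum.inl (x, c')) = ∑ x ∈ Finset.Iic a, e (Sum.inl (x, c')) +
      ∑ x, if a < x then e (Sum.inl (x, c')) else 0 := by
    rw [← Finset.sum_filter, ← Finset.sum_filter_add_sum_filter_not _ (fun x => x ≤ a)]
    congr 2
    · ext; simp
    · ext; simp
  have hIio : ∑ x ∈ Finset.Iio a, e (Sum.inl (x, c)) =
      ∑ x, if x < a then e (Sum.inl (x, c)) else 0 := by
    rw [← Finset.sum_filter]
    congr 1
    ext; simp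
  omega

end Shear

end SMB

namespace SMB

open MvPolynomial

variable {n m q : ℕ} {K : Type} [Field K]

/-- Interchanging the roles of `U` and `W` by transposition. -/
def swapCoord : Coord n m q → Coord n q m
  | Sum.inl (a, k) => Sum.inr (k, a)
  | Sum.inr (k, b) => Sum.inl (b, k)

theorem swapCoord_injective : Function.Injective (swapCoord : Coord n m q → Coord n q m) :=
  Function.LeftInverse.injective (g := swapCoord) fun i => by
    rcases i with ⟨a, k⟩ | ⟨k, b⟩ <;> rfl

theorem IsSLInvariant.rename_swapCoord {f : KX K n m q} (hf : IsSLInvariant f) :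
    IsSLInvariant (rename swapCoord f : KX K n q m) := by
  intro A U W
  have hA : (A : Matrix (Fin n) (Fin n) K) *
      ((A⁻¹ : Matrix.SpecialLinearGroup (Fin n) K) : Matrix (Fin n) (Fin n) K) = 1 := by
    rw [← Matrix.SpecialLinearGroup.coe_mul, mul_inv_cancel, Matrix.SpecialLinearGroup.coe_one]
  simp only [evalX, eval_rename]
  refine Eq.trans ?_ (hf.eval_actPoint
    (A := ((A⁻¹ : Matrix.SpecialLinearGroup (Fin n) K) : Matrix (Fin n) (Fin n) K).transpose)
    (B := (A : Matrix (Fin n) (Fin n) K).transpose)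
    (by rw [Matrix.det_transpose, (A⁻¹).2])
    (by rw [← Matrix.transpose_mul, hA, Matrix.transpose_one]) _)
  congr 2
  funext i
  rcases i with ⟨a, k⟩ | ⟨k, b⟩ <;> simp [swapCoord, actPoint, Matrix.mul_apply, mul_comm]

theorem lexWeight_mapDomain_swapCoord (d : Coord n m q →₀ ℕ) :
    lexWeight n q m (d.mapDomain swapCoord) = lexWeight n m q d := by
  have h1 : (colWeight : Coord n q m → ℕ) ∘ swapCoord = (colWeight : Coord n m q → ℕ) := by
    funext i
    rcases i with ⟨a, k⟩ | ⟨k, b⟩ <;> rfl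
  have h2 : (diagWeight : Coord n q m → ℕ) ∘ swapCoord = (diagWeight : Coord n m q → ℕ) := by
    funext i
    rcases i with ⟨a, k⟩ | ⟨k, b⟩ <;> rfl
  simp only [lexWeight, AddMonoidHom.coe_mk, ZeroHom.coe_mk, weight_mapDomain, h1, h2]

/-- The lattice-word inequality on leading monomials of invariants, for `W`. -/
theorem IsSLInvariant.sum_Iic_le' [Infinite K] {f : KX K n m q} (hf : IsSLInvariant f)
    {e : Coord n m q →₀ ℕ} (he : coeff e f ≠ 0)
    (hmax : ∀ d, coeff d f ≠ 0 → lexWeight n m q d ≤ lexWeight n m q e) {c c' : Fin n}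
    (hc : (c' : ℕ) = c + 1) (b : Fin q) :
    ∑ x ∈ Finset.Iic b, e (Sum.inr (c', x)) ≤ ∑ x ∈ Finset.Iio b, e (Sum.inr (c, x)) := by
  have key := hf.rename_swapCoord.sum_Iic_le (e := e.mapDomain swapCoord)
    (by rwa [coeff_rename_mapDomain _ swapCoord_injective]) (fun d hd => by
      obtain ⟨u, rfl, hu⟩ := coeff_rename_ne_zero _ _ _ hd
      rw [lexWeight_mapDomain_swapCoord, lexWeight_mapDomain_swapCoord]
      exact hmax u hu) hc b
  have h : ∀ (k : Fin n) (x : Fin q), e.mapDomain swapCoord (Sum.inl (x, k) : Coord n q m) =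
      e (Sum.inr (k, x)) := fun k x =>
    Finsupp.mapDomain_apply (swapCoord_injective (n := n) (m := m) (q := q)) e (Sum.inr (k, x))
  simpa only [h] using key

end SMB

namespace SMB

section Columns

variable {N n r r' : ℕ}

/-- The exponent matrix of an increasing tuple, whose `c`-th entry is placed in column `c`. -/
def rowInd (A : Fin r → Fin N) (x : Fin N) (c : Fin n) : ℕ :=
  if h : (c : ℕ) < r then if A ⟨c, h⟩ = x then 1 else 0 else 0

theorem rowInd_ne_zero_iff {A : Fin r → Fin N} {x : Fin N} {c : Fin n} :
    rowInd A x c ≠ 0 ↔ ∃ h : (c : ℕ) < r, A ⟨c, h⟩ = x := by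
  unfold rowInd
  split_ifs with h1 h2
  · exact ⟨fun _ => ⟨h1, h2⟩, fun _ => one_ne_zero⟩
  · exact ⟨fun h => absurd rfl h, fun ⟨_, h⟩ => absurd h h2⟩
  · exact ⟨fun h => absurd rfl h, fun ⟨h, _⟩ => absurd h h1⟩

theorem sum_rowInd (A : Fin r → Fin N) (S : Finset (Fin N)) (c : Fin n) :
    ∑ x ∈ S, rowInd A x c = if h : (c : ℕ) < r then if A ⟨c, h⟩ ∈ S then 1 else 0 else 0 := by
  unfold rowInd
  split_ifs with h1 h2 <;> simp_all

/-- The entries of `A` are the minima of the nonempty columns of `u`. -/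
structure IsColMin (u : Fin N → Fin n → ℕ) (A : Fin r → Fin N) : Prop where
  ne_zero : ∀ (c : Fin n) (h : (c : ℕ) < r), u (A ⟨c, h⟩) c ≠ 0
  le : ∀ x c, u x c ≠ 0 → ∃ h : (c : ℕ) < r, A ⟨c, h⟩ ≤ x

theorem IsColMin.length_le {u : Fin N → Fin n → ℕ} {A : Fin r → Fin N} {B : Fin r' → Fin N}
    (hA : IsColMin u A) (hB : IsColMin u B) (hr : r ≤ n) : r ≤ r' := by
  by_contra hlt
  obtain ⟨h, -⟩ := hB.le _ _ (hA.ne_zero ⟨r', by omega⟩ (not_le.1 hlt))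
  exact lt_irrefl _ h

theorem IsColMin.unique {u : Fin N → Fin n → ℕ} {A B : Fin r → Fin N}
    (hA : IsColMin u A) (hB : IsColMin u B) (hr : r ≤ n) : A = B := by
  funext i
  exact le_antisymm (hA.le _ _ (hB.ne_zero ⟨i, i.2.trans_le hr⟩ i.2)).2
    (hB.le _ _ (hA.ne_zero ⟨i, i.2.trans_le hr⟩ i.2)).2

theorem IsColMin.geTup {u : Fin N → Fin n → ℕ} {A : Fin r → Fin N} {B : Fin r' → Fin N}
    (hA : IsColMin u A) (hr' : r' ≤ n) (hB : ∀ x c, rowInd B x c ≤ u x c) : geTup B A := by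
  have key : ∀ j : Fin r', ∃ h : (j : ℕ) < r, A ⟨j, h⟩ ≤ B j := by
    intro j
    refine hA.le (B j) ⟨j, j.2.trans_le hr'⟩ ?_
    have h1 : rowInd B (B j) (⟨j, j.2.trans_le hr'⟩ : Fin n) ≠ 0 :=
      rowInd_ne_zero_iff.2 ⟨j.2, rfl⟩
    have := hB (B j) ⟨j, j.2.trans_le hr'⟩
    omega
  refine ⟨?_, fun j => (key j).2⟩
  by_contra hlt
  exact lt_irrefl _ (key ⟨r, not_le.1 hlt⟩).1

theorem IsColMin.rowInd_le {u : Fin N → Fin n → ℕ} {A : Fin r → Fin N} (hA : IsColMin u A)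
    (x : Fin N) (c : Fin n) : rowInd A x c ≤ u x c := by
  by_cases h : rowInd A x c = 0
  · omega
  · obtain ⟨h1, h2⟩ := rowInd_ne_zero_iff.1 h
    have h3 := hA.ne_zero c h1
    have h4 : rowInd A x c ≤ 1 := by
      unfold rowInd
      split_ifs
      all_goals omega
    rw [h2] at h3
    omega

/-- The lattice word condition on an exponent matrix. -/
def IsLattice (u : Fin N → Fin n → ℕ) : Prop :=
  ∀ c c' : Fin n, (c' : ℕ) = c + 1 → ∀ a,
    ∑ x ∈ Finset.Iic a, u x c' ≤ ∑ x ∈ Finset.Iio a, u x c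

theorem IsLattice.exists_lt {u : Fin N → Fin n → ℕ} (hu : IsLattice u) {c c' : Fin n}
    (hc : (c' : ℕ) = c + 1) {a : Fin N} (ha : u a c' ≠ 0) : ∃ x < a, u x c ≠ 0 := by
  have h1 : u a c' ≤ ∑ x ∈ Finset.Iic a, u x c' :=
    Finset.single_le_sum (f := fun x => u x c') (fun _ _ => Nat.zero_le _) (by simp)
  have h2 := hu c c' hc a
  obtain ⟨x, hx, hx0⟩ := Finset.exists_ne_zero_of_sum_ne_zero
    (show ∑ x ∈ Finset.Iio a, u x c ≠ 0 by omega)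
  exact ⟨x, Finset.mem_Iio.1 hx, hx0⟩

theorem IsLattice.exists_isColMin {u : Fin N → Fin n → ℕ} (hu : IsLattice u) :
    ∃ r ≤ n, ∃ A : Fin r → Fin N, StrictMono A ∧ IsColMin u A := by
  classical
  have hex : ∃ r, ∀ x (c : Fin n), u x c ≠ 0 → (c : ℕ) < r := ⟨n, fun _ c _ => c.2⟩
  obtain ⟨hr, hmin⟩ := (⟨Nat.find_spec hex, fun k => Nat.find_min hex (m := k)⟩ :
    (∀ x (c : Fin n), u x c ≠ 0 → (c : ℕ) < Nat.find hex) ∧ ∀ k, k < Nat.find hex →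
      ¬ ∀ x (c : Fin n), u x c ≠ 0 → (c : ℕ) < k)
  have hle : Nat.find hex ≤ n := Nat.find_min' hex fun _ c _ => c.2
  generalize Nat.find hex = r at hr hmin hle
  have hne : ∀ k (c : Fin n), (c : ℕ) + k + 1 = r → ∃ x, u x c ≠ 0 := by
    intro k
    induction k with
    | zero =>
      intro c hc
      have := hmin c (by omega)
      push Not at this
      obtain ⟨x, c', hx, hcc'⟩ := this
      have := hr x c' hx
      obtain rfl : c' = c := Fin.ext (by omega)
      exact ⟨x, hx⟩
    | succ k ih =>
      intro c hc
      obtain ⟨x, hx⟩ := ih ⟨c + 1, by omega⟩ (by simp only; omega)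
      obtain ⟨y, -, hy⟩ := hu.exists_lt rfl hx
      exact ⟨y, hy⟩
  have hA : ∀ i : Fin r, ∃ x, u x (Fin.castLE hle i) ≠ 0 ∧
      ∀ y, u y (Fin.castLE hle i) ≠ 0 → x ≤ y := by
    intro i
    have hS : (Finset.univ.filter fun x => u x (Fin.castLE hle i) ≠ 0).Nonempty := by
      obtain ⟨x, hx⟩ := hne (r - 1 - i) (Fin.castLE hle i) (by simp; omega)
      exact ⟨x, by simpa using hx⟩
    refine ⟨_, (Finset.mem_filter.1 (Finset.min'_mem _ hS)).2, fun y hy => ?_⟩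
    exact Finset.min'_le _ _ (by simpa using hy)
  choose A hA1 hA2 using hA
  refine ⟨r, hle, A, ?_, fun c h => hA1 ⟨c, h⟩, fun x c hx => ⟨hr x c hx, hA2 ⟨c, _⟩ x hx⟩⟩
  have hlt : ∀ k (i j : Fin r), (j : ℕ) = i + k + 1 → A i < A j := by
    intro k
    induction k with
    | zero =>
      intro i j hij
      obtain ⟨x, hx, hx0⟩ := hu.exists_lt (c := Fin.castLE hle i) (c' := Fin.castLE hle j)
        hij (hA1 j)
      exact (hA2 i x hx0).trans_lt hx
    | succ k ih =>
      intro i j hij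
      obtain ⟨x, hx, hx0⟩ := hu.exists_lt (c := ⟨i + k + 1, by omega⟩) (c' := Fin.castLE hle j)
        hij (hA1 j)
      exact (ih i ⟨i + k + 1, by omega⟩ rfl).trans ((hA2 ⟨i + k + 1, _⟩ x hx0).trans_lt hx)
  intro i j hij
  exact hlt (j - i - 1) i j (by have := Fin.lt_def.1 hij; omega)

theorem IsLattice.of_add_rowInd {u v : Fin N → Fin n → ℕ} {A : Fin r → Fin N} (hu : IsLattice u)
    (hA : IsColMin u A) (huv : ∀ x c, u x c = v x c + rowInd A x c) : IsLattice v := by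
  intro c c' hc a
  have h := hu c c' hc a
  simp only [huv, Finset.sum_add_distrib] at h
  by_cases hz : ∑ x ∈ Finset.Iic a, u x c' = 0
  · simp only [huv, Finset.sum_add_distrib] at hz
    omega
  · obtain ⟨x, hx, hx0⟩ := Finset.exists_ne_zero_of_sum_ne_zero hz
    obtain ⟨h1, h2⟩ := hA.le _ _ hx0
    have h3 : ∑ x ∈ Finset.Iic a, rowInd A x c' = 1 := by
      rw [sum_rowInd, dif_pos h1, if_pos (Finset.mem_Iic.2 (h2.trans (Finset.mem_Iic.1 hx)))]
    have h4 : ∑ x ∈ Finset.Iio a, rowInd A x c ≤ 1 := by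
      rw [sum_rowInd]
      split_ifs <;> omega
    omega

end Columns

section Standard

variable {n m q : ℕ}

/-- The row indices occurring in an element of `H`. -/
def rowsU : HElt n m q → Σ r, Fin r → Fin m
  | Sum.inl I => ⟨n, I.f⟩
  | Sum.inr (Sum.inl _) => ⟨0, Fin.elim0⟩
  | Sum.inr (Sum.inr P) => ⟨P.val.s, P.val.rows⟩

/-- The column indices occurring in an element of `H`. -/
def colsW : HElt n m q → Σ r, Fin r → Fin q
  | Sum.inl _ => ⟨0, Fin.elim0⟩
  | Sum.inr (Sum.inl J) => ⟨n, J.f⟩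
  | Sum.inr (Sum.inr P) => ⟨P.val.s, P.val.cols⟩

theorem rowsU_fst_le (h : HElt n m q) : (rowsU h).1 ≤ n := by
  rcases h with I | J | P
  exacts [le_rfl, Nat.zero_le _, P.2.2]

theorem colsW_fst_le (h : HElt n m q) : (colsW h).1 ≤ n := by
  rcases h with I | J | P
  exacts [Nat.zero_le _, le_rfl, P.2.2]

theorem sum_ite_castLE_eq {r N : ℕ} (hr : r ≤ n) (A : Fin r → Fin N) (x : Fin N) (c : Fin n) :
    (∑ i, if A i = x ∧ Fin.castLE hr i = c then 1 else 0) = rowInd A x c := by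
  unfold rowInd
  split_ifs with h1 h2
  · rw [Finset.sum_eq_single ⟨c, h1⟩]
    · simp [h2]
    · intro i _ hi
      rw [if_neg]
      rintro ⟨-, h⟩
      exact hi (Fin.ext (congrArg (Fin.val (n := n)) h))
    · simp
  · refine Finset.sum_eq_zero fun i _ => if_neg ?_
    rintro ⟨h, h'⟩
    subst h'
    exact h2 h
  · refine Finset.sum_eq_zero fun i _ => if_neg ?_
    rintro ⟨h, h'⟩
    subst h'
    exact h1 i.2

theorem leadExp_inl (h : HElt n m q) (x : Fin m) (c : Fin n) :
    leadExp h (Sum.inl (x, c)) = rowInd (rowsU h).2 x c := by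
  rcases h with I | J | P
  · rw [rowsU, ← sum_ite_castLE_eq le_rfl]
    simp [leadExp, Finsupp.finsetSum_apply, Finsupp.single_apply]
  · simp [leadExp, Finsupp.finsetSum_apply, rowsU, rowInd]
  · rw [rowsU, ← sum_ite_castLE_eq P.2.2]
    simp [leadExp, Finsupp.finsetSum_apply, Finsupp.single_apply]

theorem leadExp_inr (h : HElt n m q) (c : Fin n) (x : Fin q) :
    leadExp h (Sum.inr (c, x)) = rowInd (colsW h).2 x c := by
  rcases h with I | J | P
  · simp [leadExp, Finsupp.finsetSum_apply, colsW, rowInd]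
  · rw [colsW, ← sum_ite_castLE_eq le_rfl]
    simp [leadExp, Finsupp.finsetSum_apply, Finsupp.single_apply, and_comm]
  · rw [colsW, ← sum_ite_castLE_eq P.2.2]
    simp only [and_comm (a := P.val.cols _ = x)]
    simp [leadExp, Finsupp.finsetSum_apply, Finsupp.single_apply]

theorem geTup_trans {N r s t : ℕ} {A : Fin r → Fin N} {B : Fin s → Fin N} {C : Fin t → Fin N}
    (h1 : geTup A B) (h2 : geTup B C) : geTup A C :=
  ⟨h1.1.trans h2.1, fun j => (h2.2 (Fin.castLE h1.1 j)).trans (h1.2 j)⟩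

theorem geTup_refl {N r : ℕ} (A : Fin r → Fin N) : geTup A A := ⟨le_rfl, fun _ => le_rfl⟩

theorem hle_inl_iff {I : IncTup n m} {g : HElt n m q} :
    hle (Sum.inl I) g ↔ (∀ J, g ≠ Sum.inr (Sum.inl J)) ∧ geTup (rowsU g).2 I.f := by
  rcases g with I' | J' | P'
  · exact ⟨fun h => ⟨fun _ => by simp, le_rfl, h⟩, fun h => h.2.2⟩
  · exact ⟨fun h => h.elim, fun h => (h.1 J' rfl).elim⟩
  · exact ⟨fun h => ⟨fun _ => by simp, h⟩, fun h => h.2⟩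

theorem hle_xi_iff {J : IncTup n q} {g : HElt n m q} :
    hle (Sum.inr (Sum.inl J)) g ↔ (∀ I, g ≠ Sum.inl I) ∧ geTup (colsW g).2 J.f := by
  rcases g with I' | J' | P'
  · exact ⟨fun h => h.elim, fun h => (h.1 I' rfl).elim⟩
  · exact ⟨fun h => ⟨fun _ => by simp, le_rfl, h⟩, fun h => h.2.2⟩
  · exact ⟨fun h => ⟨fun _ => by simp, h⟩, fun h => h.2⟩

theorem hle_p_iff {P : {x : PairIx m q // 0 < x.s ∧ x.s ≤ n}} {g : HElt n m q} :
    hle (Sum.inr (Sum.inr P)) g ↔ (∀ I, g ≠ Sum.inl I) ∧ (∀ J, g ≠ Sum.inr (Sum.inl J)) ∧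
      geTup (rowsU g).2 P.val.rows ∧ geTup (colsW g).2 P.val.cols := by
  rcases g with I' | J' | P'
  · exact ⟨fun h => h.elim, fun h => (h.1 I' rfl).elim⟩
  · exact ⟨fun h => h.elim, fun h => (h.2.1 J' rfl).elim⟩
  · exact ⟨fun h => ⟨fun _ => by simp, fun _ => by simp, h⟩, fun h => h.2.2⟩

theorem hle_refl (h : HElt n m q) : hle h h := by
  rcases h with I | J | P
  exacts [fun _ => le_rfl, fun _ => le_rfl, ⟨geTup_refl _, geTup_refl _⟩]

theorem hle_trans {a b c : HElt n m q} (h1 : hle a b) (h2 : hle b c) : hle a c := by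
  rcases a with I | J | P <;> rcases b with I' | J' | P' <;> rcases c with I'' | J'' | P'' <;>
    first
    | exact h1.elim
    | exact h2.elim
    | exact fun j => (h1 j).trans (h2 j)
    | exact geTup_trans h2 h1
    | exact ⟨(h2.1).trans le_rfl, fun j => (h1 _).trans (h2.2 j)⟩
    | exact geTup_trans h2.1 h1
    | exact geTup_trans h2.2 h1
    | exact ⟨geTup_trans h2.1 h1.1, geTup_trans h2.2 h1.2⟩

theorem isStandardList_iff_pairwise {L : List (HElt n m q)} : IsStandardList L ↔
    (¬ ((∃ I : IncTup n m, Sum.inl I ∈ L) ∧ (∃ J : IncTup n q, Sum.inr (Sum.inl J) ∈ L))) ∧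
      L.Pairwise fun a b => hle b a :=
  have : Trans (fun a b : HElt n m q => hle b a) (fun a b => hle b a) (fun a b => hle b a) :=
    ⟨fun h1 h2 => hle_trans h2 h1⟩
  and_congr_right fun _ => List.isChain_iff_pairwise

theorem isStandardList_concat_iff {L : List (HElt n m q)} {h : HElt n m q} :
    IsStandardList (L ++ [h]) ↔ IsStandardList L ∧ ∀ g ∈ L, hle h g := by
  simp only [isStandardList_iff_pairwise, List.pairwise_append, List.mem_append,
    List.mem_singleton]
  constructor
  · rintro ⟨h1, h2, -, h3⟩
    exact ⟨⟨fun ⟨⟨I, hI⟩, J, hJ⟩ => h1 ⟨⟨I, Or.inl hI⟩, J, Or.inl hJ⟩, h2⟩,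
      fun g hg => h3 g hg h rfl⟩
  · rintro ⟨⟨h1, h2⟩, h3⟩
    refine ⟨?_, h2, List.pairwise_singleton _ _, fun a ha b hb => hb ▸ h3 a ha⟩
    rintro ⟨⟨I, hI⟩, J, hJ⟩
    rcases hI with hI | hI <;> rcases hJ with hJ | hJ
    · exact h1 ⟨⟨I, hI⟩, J, hJ⟩
    · subst hJ
      exact h3 _ hI
    · subst hI
      exact h3 _ hJ
    · rw [← hI] at hJ
      cases hJ

/-- The number of elements of `H_u` in a list. -/
def countU (L : List (HElt n m q)) : ℕ :=
  (L.map (Sum.elim (fun _ => 1) (Sum.elim (fun _ => 0) fun _ => 0))).sum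

/-- The number of elements of `H_ξ` in a list. -/
def countXi (L : List (HElt n m q)) : ℕ :=
  (L.map (Sum.elim (fun _ => 0) (Sum.elim (fun _ => 1) fun _ => 0))).sum

theorem countU_ne_zero_iff {L : List (HElt n m q)} :
    countU L ≠ 0 ↔ ∃ I, Sum.inl I ∈ L := by
  simp only [countU, ne_eq, List.sum_eq_zero_iff, List.mem_map]
  push Not
  constructor
  · rintro ⟨_, ⟨I | J | P, hg, rfl⟩, h⟩
    exacts [⟨I, hg⟩, absurd rfl h, absurd rfl h]
  · rintro ⟨I, hI⟩
    exact ⟨1, ⟨_, hI, rfl⟩, one_ne_zero⟩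

theorem countXi_ne_zero_iff {L : List (HElt n m q)} :
    countXi L ≠ 0 ↔ ∃ J, Sum.inr (Sum.inl J) ∈ L := by
  simp only [countXi, ne_eq, List.sum_eq_zero_iff, List.mem_map]
  push Not
  constructor
  · rintro ⟨_, ⟨I | J | P, hg, rfl⟩, h⟩
    exacts [absurd rfl h, ⟨J, hg⟩, absurd rfl h]
  · rintro ⟨J, hJ⟩
    exact ⟨1, ⟨_, hJ, rfl⟩, one_ne_zero⟩

theorem sum_leadExp_column (h : HElt n m q) (c : Fin n) :
    ∑ x, leadExp h (Sum.inl (x, c)) + countXi [h] =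
      ∑ x, leadExp h (Sum.inr (c, x)) + countU [h] := by
  simp only [leadExp_inl, leadExp_inr, sum_rowInd]
  rcases h with I | J | P <;> simp [rowsU, colsW, countU, countXi]

theorem sum_map_leadExp_column (L : List (HElt n m q)) (c : Fin n) :
    ∑ x, (L.map leadExp).sum (Sum.inl (x, c)) + countXi L =
      ∑ x, (L.map leadExp).sum (Sum.inr (c, x)) + countU L := by
  induction L with
  | nil => simp [countU, countXi]
  | cons h L ih =>
    have := sum_leadExp_column h c
    simp only [countU, countXi, List.map_cons, List.sum_cons, List.map_nil, List.sum_nil,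
      Finsupp.add_apply, Finset.sum_add_distrib] at *
    omega

theorem leadExp_ne_zero (hn : 0 < n) (h : HElt n m q) : leadExp h ≠ 0 := by
  intro h0
  have h1 := fun x => leadExp_inl h x ⟨0, hn⟩
  have h2 := fun x => leadExp_inr h ⟨0, hn⟩ x
  simp only [h0, Finsupp.coe_zero, Pi.zero_apply] at h1 h2
  rcases h with I | J | P
  · exact rowInd_ne_zero_iff.2 ⟨hn, rfl⟩ (h1 _).symm
  · exact rowInd_ne_zero_iff.2 ⟨hn, rfl⟩ (h2 _).symm
  · exact rowInd_ne_zero_iff.2 ⟨P.2.1, rfl⟩ (h1 _).symm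

theorem sum_map_leadExp_apply_ne_zero {L : List (HElt n m q)} {i : Coord n m q}
    (h : (L.map leadExp).sum i ≠ 0) : ∃ g ∈ L, leadExp g i ≠ 0 := by
  induction L with
  | nil => simp at h
  | cons g L ih =>
    by_cases hg : leadExp g i = 0
    · rw [List.map_cons, List.sum_cons, Finsupp.add_apply, hg, zero_add] at h
      obtain ⟨g', hg', h'⟩ := ih h
      exact ⟨g', List.mem_cons_of_mem _ hg', h'⟩
    · exact ⟨g, List.mem_cons_self, hg⟩

theorem leadExp_le_sum {L : List (HElt n m q)} {g : HElt n m q} (hg : g ∈ L) :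
    leadExp g ≤ (L.map leadExp).sum :=
  List.le_sum_of_mem (List.mem_map_of_mem hg)

theorem isColMin_rows {L : List (HElt n m q)} {r : ℕ} {A : Fin r → Fin m} {h : HElt n m q}
    (hh : h ∈ L) (hA : rowsU h = ⟨r, A⟩) (hle : ∀ g ∈ L, geTup (rowsU g).2 A) :
    IsColMin (fun x c => (L.map leadExp).sum (Sum.inl (x, c))) A := by
  refine ⟨fun c hc => ?_, fun x c hx => ?_⟩
  · have h1 := leadExp_le_sum hh (Sum.inl (A ⟨c, hc⟩, c))
    rw [leadExp_inl, hA] at h1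
    have h2 : rowInd A (A ⟨c, hc⟩) c ≠ 0 := rowInd_ne_zero_iff.2 ⟨hc, rfl⟩
    simp only at h1 ⊢
    omega
  · obtain ⟨g, hg, h1⟩ := sum_map_leadExp_apply_ne_zero hx
    rw [leadExp_inl] at h1
    obtain ⟨h2, rfl⟩ := rowInd_ne_zero_iff.1 h1
    obtain ⟨h3, h4⟩ := hle g hg
    exact ⟨h2.trans_le h3, h4 ⟨c, h2⟩⟩

theorem isColMin_cols {L : List (HElt n m q)} {r : ℕ} {A : Fin r → Fin q} {h : HElt n m q}
    (hh : h ∈ L) (hA : colsW h = ⟨r, A⟩) (hle : ∀ g ∈ L, geTup (colsW g).2 A) :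
    IsColMin (fun x c => (L.map leadExp).sum (Sum.inr (c, x))) A := by
  refine ⟨fun c hc => ?_, fun x c hx => ?_⟩
  · have h1 := leadExp_le_sum hh (Sum.inr (c, A ⟨c, hc⟩))
    rw [leadExp_inr, hA] at h1
    have h2 : rowInd A (A ⟨c, hc⟩) c ≠ 0 := rowInd_ne_zero_iff.2 ⟨hc, rfl⟩
    simp only at h1 ⊢
    omega
  · obtain ⟨g, hg, h1⟩ := sum_map_leadExp_apply_ne_zero hx
    rw [leadExp_inr] at h1
    obtain ⟨h2, rfl⟩ := rowInd_ne_zero_iff.1 h1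
    obtain ⟨h3, h4⟩ := hle g hg
    exact ⟨h2.trans_le h3, h4 ⟨c, h2⟩⟩

/-- The exponent vectors which turn out to be the leading exponents of standard monomials. -/
structure IsLatticeExp (d : Coord n m q →₀ ℕ) : Prop where
  torus : ∀ c c', ∑ x, d (Sum.inl (x, c)) + ∑ x, d (Sum.inr (c', x)) =
    ∑ x, d (Sum.inl (x, c')) + ∑ x, d (Sum.inr (c, x))
  left : IsLattice fun x c => d (Sum.inl (x, c))
  right : IsLattice fun x c => d (Sum.inr (c, x))

/-- A description of the least factor of a standard monomial in terms of its leading exponent. -/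
inductive IsLeast (d : Coord n m q →₀ ℕ) : HElt n m q → Prop
  | u (I : IncTup n m) (hI : IsColMin (fun x c => d (Sum.inl (x, c))) I.f)
      (hlt : ∀ c, ∑ x, d (Sum.inr (c, x)) < ∑ x, d (Sum.inl (x, c))) : IsLeast d (Sum.inl I)
  | xi (J : IncTup n q) (hJ : IsColMin (fun x c => d (Sum.inr (c, x))) J.f)
      (hlt : ∀ c, ∑ x, d (Sum.inl (x, c)) < ∑ x, d (Sum.inr (c, x))) :
      IsLeast d (Sum.inr (Sum.inl J))
  | p (P : {x : PairIx m q // 0 < x.s ∧ x.s ≤ n})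
      (hR : IsColMin (fun x c => d (Sum.inl (x, c))) P.val.rows)
      (hC : IsColMin (fun x c => d (Sum.inr (c, x))) P.val.cols)
      (heq : ∀ c, ∑ x, d (Sum.inl (x, c)) = ∑ x, d (Sum.inr (c, x))) :
      IsLeast d (Sum.inr (Sum.inr P))

theorem IsLeast.unique (hn : 0 < n) {d : Coord n m q →₀ ℕ} {h h' : HElt n m q}
    (hh : IsLeast d h) (hh' : IsLeast d h') : h = h' := by
  cases hh with
  | u I hI hlt =>
    cases hh' with
    | u I' hI' _ =>
      obtain ⟨f, hf⟩ := I
      obtain ⟨f', hf'⟩ := I'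
      obtain rfl : f = f' := hI.unique hI' le_rfl
      rfl
    | xi J' _ hlt' => exact absurd (hlt ⟨0, hn⟩) (hlt' ⟨0, hn⟩).not_gt
    | p P' _ _ heq => exact absurd (heq ⟨0, hn⟩).symm (hlt ⟨0, hn⟩).ne
  | xi J hJ hlt =>
    cases hh' with
    | u I' _ hlt' => exact absurd (hlt ⟨0, hn⟩) (hlt' ⟨0, hn⟩).not_gt
    | xi J' hJ' _ =>
      obtain ⟨f, hf⟩ := J
      obtain ⟨f', hf'⟩ := J'
      obtain rfl : f = f' := hJ.unique hJ' le_rfl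
      rfl
    | p P' _ _ heq => exact absurd (heq ⟨0, hn⟩) (hlt ⟨0, hn⟩).ne
  | p P hR hC heq =>
    cases hh' with
    | u I' _ hlt => exact absurd (heq ⟨0, hn⟩).symm (hlt ⟨0, hn⟩).ne
    | xi J' _ hlt => exact absurd (heq ⟨0, hn⟩) (hlt ⟨0, hn⟩).ne
    | p P' hR' hC' _ =>
      obtain ⟨⟨s, rows, cols, hrm, hcm⟩, hs⟩ := P
      obtain ⟨⟨s', rows', cols', hrm', hcm'⟩, hs'⟩ := P'
      obtain rfl : s = s' := le_antisymm (hR.length_le hR' hs.2) (hR'.length_le hR hs'.2)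
      obtain rfl : rows = rows' := hR.unique hR' hs.2
      obtain rfl : cols = cols' := hC.unique hC' hs.2
      rfl

theorem isLeast_concat {L : List (HElt n m q)} {h : HElt n m q}
    (hL : IsStandardList (L ++ [h])) : IsLeast ((L ++ [h]).map leadExp).sum h := by
  have hle : ∀ g ∈ L ++ [h], hle h g := by
    intro g hg
    rcases List.mem_append.1 hg with hg | hg
    · exact (isStandardList_concat_iff.1 hL).2 g hg
    · rw [List.mem_singleton.1 hg]
      exact hle_refl h
  have hmem : h ∈ L ++ [h] := by simp
  have hcol := sum_map_leadExp_column (L ++ [h])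
  generalize L ++ [h] = M at *
  have hboth : ¬(countU M ≠ 0 ∧ countXi M ≠ 0) := by
    rw [countU_ne_zero_iff, countXi_ne_zero_iff]
    exact hL.1
  rcases h with I | J | P
  · simp only [hle_inl_iff] at hle
    refine .u I (isColMin_rows hmem rfl fun g hg => (hle g hg).2) fun c => ?_
    have h1 : countU M ≠ 0 := countU_ne_zero_iff.2 ⟨I, hmem⟩
    have := hcol c
    omega
  · simp only [hle_xi_iff] at hle
    refine .xi J (isColMin_cols hmem rfl fun g hg => (hle g hg).2) fun c => ?_
    have h1 : countXi M ≠ 0 := countXi_ne_zero_iff.2 ⟨J, hmem⟩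
    have := hcol c
    omega
  · simp only [hle_p_iff] at hle
    refine .p P (isColMin_rows hmem rfl fun g hg => (hle g hg).2.2.1)
      (isColMin_cols hmem rfl fun g hg => (hle g hg).2.2.2) fun c => ?_
    have h1 : ¬ countU M ≠ 0 := by
      rw [countU_ne_zero_iff]
      rintro ⟨I, hI⟩
      exact (hle _ hI).1 I rfl
    have h2 : ¬ countXi M ≠ 0 := by
      rw [countXi_ne_zero_iff]
      rintro ⟨J, hJ⟩
      exact (hle _ hJ).2.1 J rfl
    have := hcol c
    omega

/-- A standard monomial is determined by its leading exponent. -/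
theorem IsStandardList.eq_of_sum_eq (hn : 0 < n) {L L' : List (HElt n m q)}
    (hL : IsStandardList L) (hL' : IsStandardList L')
    (h : (L.map leadExp).sum = (L'.map leadExp).sum) : L = L' := by
  have hnil : ∀ (M : List (HElt n m q)) g, ((M ++ [g]).map leadExp).sum ≠ 0 := by
    intro M g h0
    rw [List.map_append, List.sum_append] at h0
    exact leadExp_ne_zero hn g (by simpa using (add_eq_zero.1 h0).2)
  induction L using List.reverseRecOn generalizing L' with
  | nil =>
    induction L' using List.reverseRecOn with
    | nil => rfl
    | append_singleton M g => exact absurd h.symm (hnil M g)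
  | append_singleton M g ih =>
    induction L' using List.reverseRecOn with
    | nil => exact absurd h (hnil M g)
    | append_singleton M' g' =>
      have hg := isLeast_concat hL
      rw [h] at hg
      obtain rfl := hg.unique hn (isLeast_concat hL')
      rw [ih (isStandardList_concat_iff.1 hL).1 (isStandardList_concat_iff.1 hL').1]
      simpa using h

theorem IsLatticeExp.exists_isLeast (hn : 0 < n) {d : Coord n m q →₀ ℕ} (hd : IsLatticeExp d)
    (hd0 : d ≠ 0) : ∃ h, IsLeast d h := by
  obtain ⟨r, hr, A, hA, hAmin⟩ := hd.left.exists_isColMin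
  obtain ⟨s, hs, B, hB, hBmin⟩ := hd.right.exists_isColMin
  have hT := fun c => hd.torus c ⟨0, hn⟩
  have hrn : (∀ c, ∑ x, d (Sum.inl (x, c)) ≠ 0) → r = n := by
    intro h
    by_contra hne
    obtain ⟨x, -, hx⟩ := Finset.exists_ne_zero_of_sum_ne_zero (h ⟨r, by omega⟩)
    exact lt_irrefl _ (hAmin.le _ _ hx).1
  have hsn : (∀ c, ∑ x, d (Sum.inr (c, x)) ≠ 0) → s = n := by
    intro h
    by_contra hne
    obtain ⟨x, -, hx⟩ := Finset.exists_ne_zero_of_sum_ne_zero (h ⟨s, by omega⟩)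
    exact lt_irrefl _ (hBmin.le _ _ hx).1
  rcases lt_trichotomy (∑ x, d (Sum.inl (x, ⟨0, hn⟩))) (∑ x, d (Sum.inr (⟨0, hn⟩, x)))
    with h | h | h
  · obtain rfl := hsn fun c => by have := hT c; omega
    exact ⟨_, .xi ⟨B, hB⟩ hBmin fun c => by have := hT c; omega⟩
  · have heq : ∀ c, ∑ x, d (Sum.inl (x, c)) = ∑ x, d (Sum.inr (c, x)) := fun c => by
      have := hT c; omega
    have hrs : r = s := by
      refine le_antisymm ?_ ?_
      · by_contra hlt
        have h1 := hAmin.ne_zero ⟨s, by omega⟩ (not_le.1 hlt)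
        have h2 : ∑ x, d (Sum.inr (⟨s, by omega⟩, x)) ≠ 0 := by
          rw [← heq]
          intro h0
          exact h1 (Finset.sum_eq_zero_iff.1 h0 _ (Finset.mem_univ _))
        obtain ⟨x, -, hx⟩ := Finset.exists_ne_zero_of_sum_ne_zero h2
        exact lt_irrefl _ (hBmin.le _ _ hx).1
      · by_contra hlt
        have h1 := hBmin.ne_zero ⟨r, by omega⟩ (not_le.1 hlt)
        have h2 : ∑ x, d (Sum.inl (x, ⟨r, by omega⟩)) ≠ 0 := by
          rw [heq]
          intro h0
          exact h1 (Finset.sum_eq_zero_iff.1 h0 _ (Finset.mem_univ _))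
        obtain ⟨x, -, hx⟩ := Finset.exists_ne_zero_of_sum_ne_zero h2
        exact lt_irrefl _ (hAmin.le _ _ hx).1
    subst hrs
    have hr0 : 0 < r := by
      obtain ⟨i, hi⟩ := Finsupp.ne_iff.1 hd0
      rcases i with ⟨x, c⟩ | ⟨c, x⟩
      · obtain ⟨h, -⟩ := hAmin.le x c hi
        omega
      · obtain ⟨h, -⟩ := hBmin.le x c hi
        omega
    exact ⟨_, .p ⟨⟨r, A, B, hA, hB⟩, hr0, hr⟩ hAmin hBmin heq⟩
  · obtain rfl := hrn fun c => by have := hT c; omega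
    exact ⟨_, .u ⟨A, hA⟩ hAmin fun c => by have := hT c; omega⟩

theorem IsLeast.leadExp_le {d : Coord n m q →₀ ℕ} {h : HElt n m q} (hh : IsLeast d h) :
    leadExp h ≤ d := by
  rintro (⟨x, c⟩ | ⟨c, x⟩)
  · rw [leadExp_inl]
    cases hh with
    | u I hI => exact hI.rowInd_le x c
    | xi J => simp [rowsU, rowInd]
    | p P hR => exact hR.rowInd_le x c
  · rw [leadExp_inr]
    cases hh with
    | u I hI => simp [colsW, rowInd]
    | xi J hJ => exact hJ.rowInd_le x c
    | p P hR hC => exact hC.rowInd_le x c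

theorem IsLatticeExp.of_add_leadExp {d e : Coord n m q →₀ ℕ} {h : HElt n m q}
    (hd : IsLatticeExp d) (hh : IsLeast d h) (hde : d = e + leadExp h) : IsLatticeExp e := by
  have hl : ∀ x c, d (Sum.inl (x, c)) = e (Sum.inl (x, c)) + rowInd (rowsU h).2 x c := by
    intro x c
    rw [hde, Finsupp.add_apply, leadExp_inl]
  have hr : ∀ x c, d (Sum.inr (c, x)) = e (Sum.inr (c, x)) + rowInd (colsW h).2 x c := by
    intro x c
    rw [hde, Finsupp.add_apply, leadExp_inr]
  refine ⟨fun c c' => ?_, ?_, ?_⟩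
  · have h1 := hd.torus c c'
    have h2 := sum_leadExp_column h c
    have h3 := sum_leadExp_column h c'
    simp only [hde, Finsupp.add_apply, Finset.sum_add_distrib] at h1
    omega
  · cases hh with
    | u I hI => exact hd.left.of_add_rowInd hI hl
    | xi J => simpa [hl, rowsU, rowInd] using hd.left
    | p P hR => exact hd.left.of_add_rowInd hR hl
  · cases hh with
    | u I => simpa [hr, colsW, rowInd] using hd.right
    | xi J hJ => exact hd.right.of_add_rowInd hJ hr
    | p P hR hC => exact hd.right.of_add_rowInd hC hr

theorem IsLeast.hle_of_sum {d : Coord n m q →₀ ℕ} {h : HElt n m q} (hn : 0 < n)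
    (hh : IsLeast d h) {L : List (HElt n m q)} (hL : IsStandardList L)
    (hd : d = (L.map leadExp).sum + leadExp h) : ∀ g ∈ L, hle h g := by
  have hboth : ¬(countU L ≠ 0 ∧ countXi L ≠ 0) := by
    rw [countU_ne_zero_iff, countXi_ne_zero_iff]
    exact hL.1
  have hcol := sum_map_leadExp_column L ⟨0, hn⟩
  have hcol' := sum_leadExp_column h ⟨0, hn⟩
  have hle : ∀ g ∈ L, leadExp g ≤ d := fun g hg =>
    (leadExp_le_sum hg).trans (hd ▸ le_self_add)
  have hrow : ∀ g ∈ L, ∀ {r} {A : Fin r → Fin m},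
      IsColMin (fun x c => d (Sum.inl (x, c))) A → geTup (rowsU g).2 A := fun g hg _ _ hA =>
    hA.geTup (rowsU_fst_le g) fun x c => leadExp_inl g x c ▸ hle g hg _
  have hcl : ∀ g ∈ L, ∀ {r} {A : Fin r → Fin q},
      IsColMin (fun x c => d (Sum.inr (c, x))) A → geTup (colsW g).2 A := fun g hg _ _ hA =>
    hA.geTup (colsW_fst_le g) fun x c => leadExp_inr g c x ▸ hle g hg _
  have hU : countU L = 0 → ∀ g ∈ L, ∀ I, g ≠ Sum.inl I := by
    rintro h0 g hg I rfl
    exact countU_ne_zero_iff.2 ⟨I, hg⟩ h0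
  have hXi : countXi L = 0 → ∀ g ∈ L, ∀ J, g ≠ Sum.inr (Sum.inl J) := by
    rintro h0 g hg J rfl
    exact countXi_ne_zero_iff.2 ⟨J, hg⟩ h0
  intro g hg
  cases hh with
  | u I hI hlt =>
    have h1 := hlt ⟨0, hn⟩
    simp only [hd, Finsupp.add_apply, Finset.sum_add_distrib] at h1
    simp only [countU, countXi, List.map_cons, List.map_nil, Sum.elim_inl, List.sum_singleton]
      at hcol'
    exact hle_inl_iff.2 ⟨hXi (by omega) g hg, hrow g hg hI⟩
  | xi J hJ hlt =>
    have h1 := hlt ⟨0, hn⟩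
    simp only [hd, Finsupp.add_apply, Finset.sum_add_distrib] at h1
    simp only [countU, countXi, List.map_cons, List.map_nil, Sum.elim_inl, Sum.elim_inr,
      List.sum_singleton] at hcol'
    exact hle_xi_iff.2 ⟨hU (by omega) g hg, hcl g hg hJ⟩
  | p P hR hC heq =>
    have h1 := heq ⟨0, hn⟩
    simp only [hd, Finsupp.add_apply, Finset.sum_add_distrib] at h1
    simp only [countU, countXi, List.map_cons, List.map_nil, Sum.elim_inr, List.sum_singleton]
      at hcol'
    exact hle_p_iff.2 ⟨hU (by omega) g hg, hXi (by omega) g hg, hrow g hg hR, hcl g hg hC⟩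

/-- Every lattice exponent is the leading exponent of a standard monomial. -/
theorem IsLatticeExp.exists_isStandardList (hn : 0 < n) {d : Coord n m q →₀ ℕ}
    (hd : IsLatticeExp d) : ∃ L, IsStandardList L ∧ (L.map leadExp).sum = d := by
  induction d using WellFoundedLT.induction with
  | ind d ih =>
    by_cases hd0 : d = 0
    · exact ⟨[], isStandardList_iff_pairwise.2 ⟨by simp, .nil⟩, by simp [hd0]⟩
    · obtain ⟨h, hh⟩ := hd.exists_isLeast hn hd0
      have hde : d = (d - leadExp h) + leadExp h := (tsub_add_cancel_of_le hh.leadExp_le).symm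
      have hlt : d - leadExp h < d := by
        conv_rhs => rw [hde]
        exact lt_add_of_pos_right _ (pos_iff_ne_zero.2 (leadExp_ne_zero hn h))
      obtain ⟨L, hL, hsum⟩ := ih _ hlt (hd.of_add_leadExp hh hde)
      refine ⟨L ++ [h], isStandardList_concat_iff.2 ⟨hL, hh.hle_of_sum hn hL ?_⟩, ?_⟩
      · rw [hsum]
        exact hde
      · rw [List.map_append, List.sum_append, hsum]
        simpa using hde.symm

end Standard

end SMB

namespace SMB

open MvPolynomial

variable {K : Type} [Field K] {n m q : ℕ}

theorem IsSLInvariant.isLatticeExp [Infinite K] {f : KX K n m q} (hf : IsSLInvariant f)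
    {e : Coord n m q →₀ ℕ} (he : coeff e f ≠ 0)
    (hmax : ∀ d, coeff d f ≠ 0 → lexWeight n m q d ≤ lexWeight n m q e) : IsLatticeExp e where
  torus c c' := by
    by_cases hc : c = c'
    · rw [hc]
    · exact hf.column_sum_eq he hc
  left _ _ hc a := hf.sum_Iic_le he hmax hc a
  right _ _ hc a := hf.sum_Iic_le' he hmax hc a

variable (K) in
/-- The product of the generators indexed by a list of elements of `H`. -/
noncomputable abbrev monomialOf (L : List (HElt n m q)) : KX K n m q :=
  (L.map (polyOf K n m q)).prod

theorem hasLead_monomialOf (L : List (HElt n m q)) :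
    HasLead (lexWeight n m q) (monomialOf K L) (L.map leadExp).sum :=
  hasLead_list_prod (fun h => hasLead_polyOf K h) L

theorem monomialOf_mem_slInvariants (L : List (HElt n m q)) :
    monomialOf K L ∈ slInvariants K n m q :=
  Subalgebra.list_prod_mem _ fun x hx => by
    obtain ⟨h, -, rfl⟩ := List.mem_map.1 hx
    exact polyOf_mem_slInvariants h

variable (K) in
theorem linearIndependent_monomialOf (hn : 0 < n) :
    LinearIndependent K
      (fun L : {L : List (HElt n m q) // IsStandardList L} => monomialOf K L.val) := by
  classical
  rw [linearIndependent_iff']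
  intro s c hsum
  by_contra! hcon
  have hne : (s.filter fun L => c L ≠ 0).Nonempty := by
    obtain ⟨L, hL, hcL⟩ := hcon
    exact ⟨L, Finset.mem_filter.2 ⟨hL, hcL⟩⟩
  obtain ⟨L, hL, hLmax⟩ := Finset.exists_max_image _
    (fun L => lexWeight n m q (L.val.map leadExp).sum) hne
  rw [Finset.mem_filter] at hL
  apply hL.2
  have hcoeff := congrArg (coeff (L.val.map leadExp).sum) hsum
  rw [coeff_sum, Finset.sum_eq_single_of_mem L hL.1, coeff_smul,
    (hasLead_monomialOf L.val).1, coeff_zero, smul_eq_mul, mul_one] at hcoeff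
  · exact hcoeff
  · intro L' hL' hne'
    rw [coeff_smul, smul_eq_mul]
    by_contra hprod
    refine (hLmax L' (Finset.mem_filter.2 ⟨hL', left_ne_zero_of_mul hprod⟩)).not_gt
      ((hasLead_monomialOf L'.val).2 _ (right_ne_zero_of_mul hprod) fun heq => ?_)
    exact hne' (Subtype.ext (L'.property.eq_of_sum_eq hn L.property heq.symm))

theorem mem_span_of_weight_lt [Infinite K] (hn : 0 < n) (g : ℕ ×ₗ ℕ)
    {f : KX K n m q} (hf : f ∈ slInvariants K n m q)
    (hg : ∀ d, coeff d f ≠ 0 → lexWeight n m q d < g) :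
    f ∈ Submodule.span K (Set.range
      (fun L : {L : List (HElt n m q) // IsStandardList L} => monomialOf K L.val)) := by
  classical
  induction g using WellFoundedLT.induction generalizing f with
  | ind g ih =>
    rcases eq_or_ne f 0 with rfl | hf0
    · exact Submodule.zero_mem _
    obtain ⟨e₀, he₀, hmax⟩ := Finset.exists_max_image f.support (lexWeight n m q)
      (support_nonempty.2 hf0)
    set T := f.support.filter fun d => lexWeight n m q d = lexWeight n m q e₀ with hT
    have hlat : ∀ d ∈ T, ∃ L : List (HElt n m q),
        IsStandardList L ∧ (L.map leadExp).sum = d := by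
      intro d hd
      rw [hT, Finset.mem_filter, mem_support_iff] at hd
      refine IsLatticeExp.exists_isStandardList hn
        (IsSLInvariant.isLatticeExp hf hd.1 fun d' hd' => ?_)
      rw [hd.2]
      exact hmax d' (mem_support_iff.2 hd')
    choose! L hL hLsum using hlat
    have hlead : ∀ d ∈ T, HasLead (lexWeight n m q) (monomialOf K (L d)) d := by
      intro d hd
      have := hasLead_monomialOf (K := K) (L d)
      rwa [hLsum d hd] at this
    set top := ∑ d ∈ T, coeff d f • monomialOf K (L d) with htop
    have htop_span : top ∈ Submodule.span K (Set.range
        (fun L : {L : List (HElt n m q) // IsStandardList L} => monomialOf K L.val)) :=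
      Submodule.sum_mem _ fun d hd =>
        Submodule.smul_mem _ _ (Submodule.subset_span ⟨⟨L d, hL d hd⟩, rfl⟩)
    have htop_mem : top ∈ slInvariants K n m q :=
      Subalgebra.sum_mem _ fun d _ => Subalgebra.smul_mem _ (monomialOf_mem_slInvariants _) _
    have hcoeff_top : ∀ d ∈ T, coeff d top = coeff d f := by
      intro d hd
      rw [htop, coeff_sum, Finset.sum_eq_single_of_mem d hd, coeff_smul, (hlead d hd).1,
        smul_eq_mul, mul_one]
      intro d' hd' hne
      rw [coeff_smul, smul_eq_mul]
      by_contra hprod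
      have hlt := (hlead d' hd').2 d (right_ne_zero_of_mul hprod) hne.symm
      rw [(Finset.mem_filter.1 hd).2, (Finset.mem_filter.1 hd').2] at hlt
      exact lt_irrefl _ hlt
    have hrest : f - top ∈ Submodule.span K (Set.range
        (fun L : {L : List (HElt n m q) // IsStandardList L} => monomialOf K L.val)) := by
      refine ih (lexWeight n m q e₀) (hg e₀ (mem_support_iff.1 he₀))
        (Subalgebra.sub_mem _ hf htop_mem) fun d hd => ?_
      rw [coeff_sub] at hd
      have hdT : d ∉ T := fun h => hd (by rw [hcoeff_top d h, sub_self])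
      by_cases hdf : coeff d f = 0
      · rw [hdf, zero_sub, neg_ne_zero, htop, coeff_sum] at hd
        obtain ⟨d', hd', hprod⟩ := Finset.exists_ne_zero_of_sum_ne_zero hd
        rw [coeff_smul, smul_eq_mul] at hprod
        have hlt := (hlead d' hd').2 d (right_ne_zero_of_mul hprod)
          fun h => hdT (h ▸ hd')
        rwa [(Finset.mem_filter.1 hd').2] at hlt
      · exact (hmax d (mem_support_iff.2 hdf)).lt_of_ne fun h =>
          hdT (Finset.mem_filter.2 ⟨mem_support_iff.2 hdf, h⟩)
    simpa using Submodule.add_mem _ hrest htop_span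

theorem span_monomialOf [Infinite K] (hn : 0 < n) :
    Submodule.span K (Set.range
      (fun L : {L : List (HElt n m q) // IsStandardList L} => monomialOf K L.val)) =
      Subalgebra.toSubmodule (slInvariants K n m q) := by
  apply le_antisymm
  · rw [Submodule.span_le]
    rintro _ ⟨L, rfl⟩
    exact monomialOf_mem_slInvariants L.val
  · intro f hf
    rcases eq_or_ne f 0 with rfl | hf0
    · exact Submodule.zero_mem _
    obtain ⟨e, -, hmax⟩ := Finset.exists_max_image f.support (lexWeight n m q)
      (support_nonempty.2 hf0)
    refine mem_span_of_weight_lt hn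
      (lexWeight n m q e + toLex (1, 0)) hf fun d hd => ?_
    refine (hmax d (mem_support_iff.2 hd)).trans_lt (lt_add_of_pos_right _ ?_)
    exact Prod.Lex.toLex_lt_toLex.2 (Or.inl one_pos)

end SMB

open SMB in
/-- **Standard monomial basis for `K[X]^{SL_n(K)}`.**
The standard monomials in `p(A,B)` (`(A,B) ∈ H_p`), `u(I)` (`I ∈ H_u`), `ξ(J)`
(`J ∈ H_ξ`) — including the empty monomial `1` — are linearly independent over `K` and
span the ring of invariants `K[X]^{SL_n(K)}` as a `K`-vector space; that is, they form a
`K`-basis of `K[X]^{SL_n(K)}`. -/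
theorem sl_standard_monomial_basis (K : Type) [Field K] [IsAlgClosed K]
    (n m q : ℕ) (hn : 0 < n) (hm : n < m) (hq : n < q) :
    LinearIndependent K
      (fun L : {L : List (HElt n m q) // IsStandardList L} =>
        (L.val.map (polyOf K n m q)).prod) ∧
    Submodule.span K
      (Set.range (fun L : {L : List (HElt n m q) // IsStandardList L} =>
        (L.val.map (polyOf K n m q)).prod)) =
      Subalgebra.toSubmodule (slInvariants K n m q) := by
  exact ⟨linearIndependent_monomialOf K hn, span_monomialOf hn⟩
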